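/- arXiv:2004.09092 — 3 statements merged into one kernel-verified Lean document; each statement's English description precedes it below -/
import Mathlib

section
/- Let w = w_1 w_2 ... be an infinite word over the positive integers with bounded letters. If there exists a positive integer k such that p(n,w) ≤ n + k for all n ≥ 1, then the real number α = [0; w_1, w_2, ...] has a Lévy constant, i.e., the sequence ((log Q_n)/n)_{n≥1} converges. -/
open Filter Real Matrix

noncomputable section

/-- `contQ w n` is the denominator `Q n` of the `n`-th convergent of the
continued fraction `[0; w 1, w 2, …]`. -/
def contQ (w : ℕ → ℕ) : ℕ → ℕ
  | 0 => 1
  | 1 => w 1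
  | n + 2 => w (n + 2) * contQ w (n + 1) + contQ w n

/-- The real number `[0; w 1, w 2, …]` has Lévy constant `ℓ`, i.e. the sequence
`(log Q n)/n` converges to `ℓ`. -/
def HasLevyConstant (w : ℕ → ℕ) (ℓ : ℝ) : Prop :=
  Tendsto (fun n : ℕ => Real.log (contQ w n) / n) atTop (nhds ℓ)

/-- `L` is a (finite) factor of the infinite word `w = w 1 w 2 ⋯`. -/
def IsFactorSeq (w : ℕ → ℕ) (L : List ℕ) : Prop :=
  ∃ i : ℕ, L = (List.range L.length).map fun j => w (i + j + 1)

/-- The complexity function `p(n, w)`: the number of distinct factors of length `n`. -/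
def complexity (w : ℕ → ℕ) (n : ℕ) : ℕ :=
  Set.ncard {L : List ℕ | L.length = n ∧ IsFactorSeq w L}

/-- The mechanical word `s_{θ,ρ}` over `{a,b}` (floor version), indexed from `1`. -/
def mechWord (a b : ℕ) (θ ρ : ℝ) (n : ℕ) : ℕ :=
  if ⌊(n : ℝ) * θ + ρ⌋ - ⌊((n : ℝ) - 1) * θ + ρ⌋ = 0 then a else b

/-- The mechanical word `s'_{θ,ρ}` over `{a,b}` (ceiling version), indexed from `1`. -/
def mechWord' (a b : ℕ) (θ ρ : ℝ) (n : ℕ) : ℕ :=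
  if ⌈(n : ℝ) * θ + ρ⌉ - ⌈((n : ℝ) - 1) * θ + ρ⌉ = 0 then a else b

/-- `w` is a Sturmian word over `{a, b}`: a mechanical word with irrational slope. -/
def IsSturmianWord (a b : ℕ) (w : ℕ → ℕ) : Prop :=
  ∃ θ ρ : ℝ, Irrational θ ∧ θ ∈ Set.Icc (0 : ℝ) 1 ∧ ρ ∈ Set.Ico (0 : ℝ) 1 ∧
    (w = mechWord a b θ ρ ∨ w = mechWord' a b θ ρ)

/-- The matrix `[[x, 1], [1, 0]]`. -/
def cfMat (x : ℝ) : Matrix (Fin 2) (Fin 2) ℝ := !![x, 1; 1, 0]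

/-- `T(b₁, …, b_n)`: the trace of `[[b₁,1],[1,0]] ⋯ [[b_n,1],[1,0]]` for a word
`b₁ ⋯ b_n` over the positive integers.  The trace of the empty word is `2`. -/
def traceWord (L : List ℕ) : ℝ := ((L.map fun c => cfMat (c : ℝ)).prod).trace

/-- The polynomial `𝐓_n(x) = Tr([[x,1],[1,0]]^n)`. -/
def Tpoly (n : ℕ) (x : ℝ) : ℝ := ((cfMat x) ^ n).trace

/-- The lower Christoffel word `w_{p/q}` over `{a, b}`: the prefix of length `q`
of the mechanical word `s_{p/q, 0}`. -/
def christoffel (a b p q : ℕ) : List ℕ :=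
  (List.range q).map fun n => mechWord a b ((p : ℝ) / (q : ℝ)) 0 (n + 1)

/-- `T(w_{p/q})`, the trace attached to the lower Christoffel word of slope `p/q`. -/
def Tw (a b p q : ℕ) : ℝ := traceWord (christoffel a b p q)

/-- The continuant `K(b₁, …, b_n)`: the denominator of `[0; b₁, …, b_n]`. -/
def contList : List ℕ → ℕ
  | [] => 1
  | [x] => x
  | x :: y :: t => x * contList (y :: t) + contList t

/-- The standard words attached to `d₁, d₂, …` : `sturmM a b d (k+1)` is the word
`M_k`, where `M_{-1} = b`, `M_0 = a` and `M_k = M_{k-1}^{d_k} M_{k-2}`. -/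
def sturmM (a b : ℕ) (d : ℕ → ℕ) : ℕ → List ℕ
  | 0 => [b]
  | 1 => [a]
  | k + 2 => (List.replicate (d (k + 1)) (sturmM a b d (k + 1))).flatten ++ sturmM a b d k

/-- Denominators `q_k` of the convergents of `θ = [0; 1 + d₁, d₂, d₃, …]`. -/
def cfQ (d : ℕ → ℕ) : ℕ → ℕ
  | 0 => 1
  | 1 => 1 + d 1
  | k + 2 => d (k + 2) * cfQ d (k + 1) + cfQ d k

/-- Numerators `p_k` of the convergents of `θ = [0; 1 + d₁, d₂, d₃, …]`. -/
def cfP (d : ℕ → ℕ) : ℕ → ℕ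
  | 0 => 0
  | 1 => 1
  | k + 2 => d (k + 2) * cfP d (k + 1) + cfP d k

/-- `w` is ultimately periodic (so that `[0; w 1, w 2, …]` is a quadratic irrational). -/
def UltimatelyPeriodic (w : ℕ → ℕ) : Prop :=
  ∃ r s : ℕ, 0 < s ∧ ∀ n, r < n → w (n + s) = w n

end

/-- The block `u i, …, u (i + n - 1)` of a sequence. -/
def seqBlock (u : ℕ → ℕ) (i n : ℕ) : List ℕ := (List.range n).map fun j => u (i + j)

@[simp] lemma length_seqBlock (u : ℕ → ℕ) (i n : ℕ) : (seqBlock u i n).length = n := by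
  simp [seqBlock]

lemma seqBlock_eq_iff {u : ℕ → ℕ} {i j n : ℕ} :
    seqBlock u i n = seqBlock u j n ↔ ∀ t < n, u (i + t) = u (j + t) := by
  simp [seqBlock]

lemma seqBlock_add (u : ℕ → ℕ) (i m n : ℕ) :
    seqBlock u i (m + n) = seqBlock u i m ++ seqBlock u (i + m) n := by
  simp [seqBlock, List.range_add, add_assoc]

lemma seqBlock_one (u : ℕ → ℕ) (i : ℕ) : seqBlock u i 1 = [u i] := by
  simp [seqBlock]

lemma seqBlock_append_eq {u : ℕ → ℕ} {e : ℕ} {A B : List ℕ} (hA : seqBlock u e A.length = A)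
    (hB : seqBlock u (e + A.length) B.length = B) : seqBlock u e (A ++ B).length = A ++ B := by
  rw [List.length_append, seqBlock_add, hA, hB]

/-- The `n` letters preceding position `e` agree with the `n` letters preceding position `e'`. -/
def SamePast (u : ℕ → ℕ) (n e e' : ℕ) : Prop :=
  n ≤ e ∧ n ≤ e' ∧ ∀ s < n, u (e - (s + 1)) = u (e' - (s + 1))

/-- The factor of length `n` preceding position `e` is right special. -/
def RightSpecialAt (u : ℕ → ℕ) (n e : ℕ) : Prop :=
  ∃ e', SamePast u n e e' ∧ u e ≠ u e'

namespace SamePast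

variable {u : ℕ → ℕ} {m n e e' e'' : ℕ}

lemma symm (h : SamePast u n e e') : SamePast u n e' e :=
  ⟨h.2.1, h.1, fun s hs => (h.2.2 s hs).symm⟩

lemma trans (h : SamePast u n e e') (h' : SamePast u n e' e'') : SamePast u n e e'' :=
  ⟨h.1, h'.2.1, fun s hs => (h.2.2 s hs).trans (h'.2.2 s hs)⟩

lemma mono (h : SamePast u n e e') (hm : m ≤ n) : SamePast u m e e' :=
  ⟨hm.trans h.1, hm.trans h.2.1, fun s hs => h.2.2 s (hs.trans_le hm)⟩

lemma extend (h : SamePast u n e e') {l : ℕ} (hl : ∀ t < l, u (e + t) = u (e' + t)) :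
    SamePast u (n + l) (e + l) (e' + l) := by
  obtain ⟨h1, h2, h3⟩ := h
  refine ⟨by omega, by omega, fun s hs => ?_⟩
  rcases lt_or_ge s l with hsl | hsl
  · have := hl (l - (s + 1)) (by omega)
    rwa [show e + (l - (s + 1)) = e + l - (s + 1) by omega,
      show e' + (l - (s + 1)) = e' + l - (s + 1) by omega] at this
  · have := h3 (s - l) (by omega)
    rwa [show e - (s - l + 1) = e + l - (s + 1) by omega,
      show e' - (s - l + 1) = e' + l - (s + 1) by omega] at this

lemma rightSpecialAt (h : SamePast u n e e') (he : RightSpecialAt u n e) :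
    RightSpecialAt u n e' := by
  obtain ⟨g, hg, hne⟩ := he
  by_cases hu : u e' = u e
  · exact ⟨g, h.symm.trans hg, by rwa [hu]⟩
  · exact ⟨e, h.symm, hu⟩

lemma block_eq (h : SamePast u n e e') : ∀ t < n, u (e - n + t) = u (e' - n + t) := by
  intro t ht
  obtain ⟨h1, h2, h3⟩ := h
  have := h3 (n - t - 1) (by omega)
  rwa [show e - (n - t - 1 + 1) = e - n + t by omega,
    show e' - (n - t - 1 + 1) = e' - n + t by omega] at this

end SamePast

lemma RightSpecialAt.mono {u : ℕ → ℕ} {m n e : ℕ} (h : RightSpecialAt u n e) (hm : m ≤ n) :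
    RightSpecialAt u m e := by
  obtain ⟨e', h1, h2⟩ := h
  exact ⟨e', h1.mono hm, h2⟩

/-- Two distinct positions with the same past have, further on, a common right special past,
provided the sequence is not ultimately periodic. -/
lemma exists_first_difference {u : ℕ → ℕ} (hap : ∀ i j, i ≠ j → ∃ d, u (i + d) ≠ u (j + d))
    {n e e' : ℕ} (h : SamePast u n e e') (hne : e ≠ e') :
    ∃ d, (∀ t < d, u (e + t) = u (e' + t)) ∧ SamePast u (n + d) (e + d) (e' + d) ∧
      u (e + d) ≠ u (e' + d) := by
  classical
  have hex := hap e e' hne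
  have hmin : ∀ t < Nat.find hex, u (e + t) = u (e' + t) := fun t ht =>
    not_not.1 (Nat.find_min hex ht)
  exact ⟨Nat.find hex, hmin, h.extend hmin, Nat.find_spec hex⟩

/-- A sequence with a set of positions closed under reading a fixed nonempty word is
ultimately periodic. -/
lemma false_of_forall_block {u : ℕ → ℕ} (hap : ∀ i j, i ≠ j → ∃ d, u (i + d) ≠ u (j + d))
    {P : ℕ → Prop} {A : List ℕ} (hA : A ≠ [])
    (hP : ∀ e, P e → seqBlock u e A.length = A ∧ P (e + A.length)) {e : ℕ} (he : P e) : False := by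
  have hpos : 0 < A.length := List.length_pos_iff.2 hA
  obtain ⟨d, hd⟩ := hap e (e + A.length) (by omega)
  apply hd
  clear hd
  induction d using Nat.strong_induction_on generalizing e with
  | _ d ih =>
    rcases lt_or_ge d A.length with hdl | hdl
    · exact seqBlock_eq_iff.1 ((hP e he).1.trans (hP _ (hP e he).2).1.symm) d hdl
    · have := ih (d - A.length) (by omega) (hP e he).2
      rwa [show e + A.length + (d - A.length) = e + d by omega,
        show e + A.length + A.length + (d - A.length) = e + A.length + d by omega] at this

/-! ### Sequences with a unique right special factor of each large length -/

/-- Not ultimately periodic, and from length `N` on there is exactly one right special factor,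
which can be extended to the right by `x` and `y` only. -/
structure UniqueRightSpecial (u : ℕ → ℕ) (N x y : ℕ) : Prop where
  aperiodic : ∀ i j, i ≠ j → ∃ d, u (i + d) ≠ u (j + d)
  ne : x ≠ y
  samePast : ∀ n, N ≤ n → ∀ e g, RightSpecialAt u n e → RightSpecialAt u n g → SamePast u n e g
  letter : ∀ n, N ≤ n → ∀ e, RightSpecialAt u n e → u e = x ∨ u e = y
  exists_left : ∀ n, N ≤ n → ∀ M, ∃ e, M < e ∧ RightSpecialAt u n e ∧ u e = x
  exists_right : ∀ n, N ≤ n → ∀ M, ∃ e, M < e ∧ RightSpecialAt u n e ∧ u e = y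

lemma UniqueRightSpecial.swap {u : ℕ → ℕ} {N x y : ℕ} (h : UniqueRightSpecial u N x y) :
    UniqueRightSpecial u N y x :=
  ⟨h.aperiodic, h.ne.symm, h.samePast, fun n hn e he => (h.letter n hn e he).symm,
    h.exists_right, h.exists_left⟩

/-- After an occurrence of the right special factor of length `n`, reading the letter `x` leads
along `A` to another occurrence. -/
def IsLoop (u : ℕ → ℕ) (n x : ℕ) (A : List ℕ) : Prop :=
  A ≠ [] ∧ ∀ e, RightSpecialAt u n e → u e = x →
    seqBlock u e A.length = A ∧ RightSpecialAt u n (e + A.length)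

namespace UniqueRightSpecial

variable {u : ℕ → ℕ} {N x y n : ℕ} {A B : List ℕ}

lemma exists_isLoop (h : UniqueRightSpecial u N x y) (hn : N ≤ n) : ∃ A, IsLoop u n x A := by
  classical
  obtain ⟨e, -, he, hex⟩ := h.exists_left n hn 0
  have hret : ∃ l, 0 < l ∧ RightSpecialAt u n (e + l) := by
    obtain ⟨g, hg, hg', -⟩ := h.exists_left n hn e
    exact ⟨g - e, by omega, by rwa [show e + (g - e) = g by omega]⟩
  obtain ⟨hl0, hl⟩ := Nat.find_spec hret
  have hmin : ∀ t < Nat.find hret, 0 < t → ¬ RightSpecialAt u n (e + t) :=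
    fun t ht ht0 hr => Nat.find_min hret ht ⟨ht0, hr⟩
  generalize Nat.find hret = l at hl0 hl hmin
  have key : ∀ g, RightSpecialAt u n g → u g = x → ∀ t < l, u (e + t) = u (g + t) := by
    intro g hg hgx t
    induction t using Nat.strong_induction_on with
    | _ t ih =>
      intro ht
      rcases Nat.eq_zero_or_pos t with rfl | ht0
      · simp [hex, hgx]
      · have hs := (h.samePast n hn e g he hg).extend (l := t)
          (fun s hs => ih s hs (hs.trans ht))
        by_contra hne
        exact hmin t ht ht0 ⟨_, hs.mono (by omega), hne⟩
  refine ⟨seqBlock u e l, ?_, fun g hg hgx => ?_⟩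
  · rw [← List.length_pos_iff]; simpa using hl0
  · rw [length_seqBlock]
    refine ⟨(seqBlock_eq_iff.2 (key g hg hgx)).symm, ?_⟩
    have hs := (h.samePast n hn e g he hg).extend (key g hg hgx)
    exact (hs.mono (Nat.le_add_right n l)).rightSpecialAt hl

lemma samePast_succ (h : UniqueRightSpecial u N x y) (hn : N ≤ n) (hA : IsLoop u n x A)
    {e g : ℕ} (he : RightSpecialAt u n e) (hex : u e = x) (hg : RightSpecialAt u n g)
    (hgx : u g = x) : SamePast u (n + 1) (e + A.length) (g + A.length) := by
  have hpos : 0 < A.length := List.length_pos_iff.2 hA.1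
  refine SamePast.mono ((h.samePast n hn e g he hg).extend (seqBlock_eq_iff.1 ?_))
    (show n + 1 ≤ n + A.length by omega)
  exact (hA.2 e he hex).1.trans (hA.2 g hg hgx).1.symm

/-- Either every loop with first letter `x` ends at an occurrence of the longer right special
factor, or all of them are followed by the same letter. -/
lemma loop_alternative (h : UniqueRightSpecial u N x y) (hn : N ≤ n) (hA : IsLoop u n x A) :
    (∀ e, RightSpecialAt u n e → u e = x → RightSpecialAt u (n + 1) (e + A.length)) ∨
      (∀ e, RightSpecialAt u n e → u e = x → u (e + A.length) = y) := by
  by_cases hr : ∃ e, RightSpecialAt u n e ∧ u e = x ∧ RightSpecialAt u (n + 1) (e + A.length)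
  · obtain ⟨e, he, hex, her⟩ := hr
    exact Or.inl fun g hg hgx => (h.samePast_succ hn hA he hex hg hgx).rightSpecialAt her
  · right
    have hconst : ∀ e g, RightSpecialAt u n e → u e = x → RightSpecialAt u n g → u g = x →
        u (e + A.length) = u (g + A.length) := by
      intro e g he hex hg hgx
      by_contra hne
      exact hr ⟨e, he, hex, _, h.samePast_succ hn hA he hex hg hgx, hne⟩
    intro e he hex
    rcases h.letter n hn _ (hA.2 e he hex).2 with hx | hy
    · refine (false_of_forall_block h.aperiodic (P := fun g => RightSpecialAt u n g ∧ u g = x)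
        hA.1 (fun g hg => ⟨(hA.2 g hg.1 hg.2).1, (hA.2 g hg.1 hg.2).2, ?_⟩) ⟨he, hex⟩).elim
      rw [hconst g e hg.1 hg.2 he hex, hx]
    · exact hy

lemma isLoop_append (hA : IsLoop u n x A) (hB : IsLoop u n y B)
    (hr : ∀ e, RightSpecialAt u n e → u e = x → RightSpecialAt u (n + 1) (e + A.length))
    (hy : ∀ e, RightSpecialAt u n e → u e = y → u (e + B.length) = x) :
    IsLoop u (n + 1) y (B ++ A) := by
  refine ⟨by simp [hB.1], fun e he hey => ?_⟩
  have he' := he.mono (Nat.le_succ n)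
  obtain ⟨h1, h2⟩ := hB.2 e he' hey
  have hx := hy e he' hey
  refine ⟨seqBlock_append_eq h1 (hA.2 _ h2 hx).1, ?_⟩
  rw [List.length_append, ← add_assoc]
  exact hr _ h2 hx

lemma exists_isLoop_succ (h : UniqueRightSpecial u N x y) (hn : N ≤ n) (hA : IsLoop u n x A)
    (hB : IsLoop u n y B) : ∃ A' B', IsLoop u (n + 1) x A' ∧ IsLoop u (n + 1) y B' ∧
      ((A' = A ∧ B' = B) ∨ (A' = A ∧ B' = B ++ A) ∨ (A' = A ++ B ∧ B' = B)) := by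
  have up : ∀ {z : ℕ} {L : List ℕ}, IsLoop u n z L →
      (∀ e, RightSpecialAt u n e → u e = z → RightSpecialAt u (n + 1) (e + L.length)) →
      IsLoop u (n + 1) z L := fun hL hr =>
    ⟨hL.1, fun e he hez => ⟨(hL.2 e (he.mono (Nat.le_succ n)) hez).1,
      hr e (he.mono (Nat.le_succ n)) hez⟩⟩
  rcases h.loop_alternative hn hA with hrA | hyA <;>
    rcases h.swap.loop_alternative hn hB with hrB | hxB
  · exact ⟨A, B, up hA hrA, up hB hrB, Or.inl ⟨rfl, rfl⟩⟩
  · exact ⟨A, B ++ A, up hA hrA, isLoop_append hA hB hrA hxB, Or.inr (Or.inl ⟨rfl, rfl⟩)⟩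
  · exact ⟨A ++ B, B, isLoop_append hB hA hrB hyA, up hB hrB, Or.inr (Or.inr ⟨rfl, rfl⟩)⟩
  · obtain ⟨e, -, he, hex⟩ := h.exists_left n hn 0
    refine (false_of_forall_block h.aperiodic (P := fun g => RightSpecialAt u n g ∧ u g = x)
      (A := A ++ B) (by simp [hA.1]) (fun g hg => ?_) ⟨he, hex⟩).elim
    obtain ⟨h1, h2⟩ := hA.2 g hg.1 hg.2
    have hy := hyA g hg.1 hg.2
    obtain ⟨h3, h4⟩ := hB.2 _ h2 hy
    refine ⟨seqBlock_append_eq h1 h3, ?_⟩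
    rw [List.length_append, ← add_assoc]
    exact ⟨h4, hxB _ h2 hy⟩

/-- Loop lengths cannot stay constant. -/
lemma exists_length_ne (h : UniqueRightSpecial u N x y) (hn : N ≤ n) (hA : IsLoop u n x A)
    (hlen : A.length ≤ n) : ∃ m, n ≤ m ∧ ∀ A', IsLoop u m x A' → A'.length ≠ A.length := by
  obtain ⟨e, -, he, hey⟩ := h.exists_right n hn 0
  obtain ⟨e', hlt, he', hey'⟩ := h.exists_right n hn e
  obtain ⟨d, -, hs, hd⟩ := exists_first_difference h.aperiodic
    (h.samePast n hn e e' he he') hlt.ne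
  have hd0 : d ≠ 0 := by
    rintro rfl
    exact hd (by simp [hey, hey'])
  refine ⟨n + d, by omega, fun A' hA' hl => h.ne ?_⟩
  have hm : N ≤ n + d := by omega
  have hapos : 0 < A.length := List.length_pos_iff.2 hA.1
  have hr : RightSpecialAt u (n + d) (e + d) := ⟨_, hs, hd⟩
  obtain ⟨g, -, hg, hgx⟩ := h.exists_left (n + d) hm 0
  have hgl := (hA'.2 g hg hgx).2
  rw [hl] at hgl
  obtain ⟨k, -, hk, hkx⟩ := h.exists_left n hn 0
  have hkl := (hA.2 k hk hkx).2
  obtain ⟨b1, b2, s1⟩ := h.samePast n hn _ _ hkl he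
  obtain ⟨b3, b4, s2⟩ := h.samePast _ hm _ _ hg hr
  obtain ⟨-, -, s3⟩ := h.samePast _ hm _ _ hgl hg
  have e1 := s1 (A.length - 1) (by omega)
  have e2 := s2 (d - 1) (by omega)
  have e3 := s2 (d + A.length - 1) (by omega)
  have e4 := s3 (d + A.length - 1) (by omega)
  rw [show k + A.length - (A.length - 1 + 1) = k by omega,
    show e - (A.length - 1 + 1) = e - A.length by omega] at e1
  rw [show e + d - (d - 1 + 1) = e by omega, show g - (d - 1 + 1) = g - d by omega] at e2
  rw [show e + d - (d + A.length - 1 + 1) = e - A.length by omega] at e3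
  rw [show g + A.length - (d + A.length - 1 + 1) = g - d by omega] at e4
  rw [← hkx, e1, ← e3, ← e4, e2, hey]

end UniqueRightSpecial

/-! ### Almost additive functions along loops -/

/-- The averages of `f` over `A` and `B` differ by at most `C (1 / |A| + 1 / |B|)`. -/
def CloseAverages (f : List ℕ → ℝ) (C : ℝ) (A B : List ℕ) : Prop :=
  |f A * B.length - f B * A.length| ≤ C * (A.length + B.length)

lemma CloseAverages.symm {f : List ℕ → ℝ} {C : ℝ} {A B : List ℕ} (h : CloseAverages f C A B) :
    CloseAverages f C B A := by
  unfold CloseAverages at *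
  rwa [abs_sub_comm, add_comm]

lemma CloseAverages.append {f : List ℕ → ℝ} {C : ℝ} {A B : List ℕ}
    (hf : ∀ A B, |f (A ++ B) - f A - f B| ≤ C) (h : CloseAverages f C A B) :
    CloseAverages f C A (B ++ A) ∧ CloseAverages f C (A ++ B) B := by
  unfold CloseAverages at *
  have ha : (0 : ℝ) ≤ A.length := Nat.cast_nonneg _
  have hb : (0 : ℝ) ≤ B.length := Nat.cast_nonneg _
  have h1 := abs_le.1 (hf B A)
  have h2 := abs_le.1 (hf A B)
  rw [abs_le] at h
  push_cast [List.length_append]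
  constructor <;> rw [abs_le] <;> constructor <;>
    nlinarith [mul_le_mul_of_nonneg_right h1.1 ha, mul_le_mul_of_nonneg_right h1.2 ha,
      mul_le_mul_of_nonneg_right h2.1 hb, mul_le_mul_of_nonneg_right h2.2 hb]

namespace UniqueRightSpecial

variable {u : ℕ → ℕ} {N x y n : ℕ} {A B : List ℕ} {f : List ℕ → ℝ} {C : ℝ}

/-- Loops at level `n` with close averages. -/
def GoodLoops (u : ℕ → ℕ) (x y : ℕ) (f : List ℕ → ℝ) (C : ℝ) (n : ℕ) (A B : List ℕ) : Prop :=
  IsLoop u n x A ∧ IsLoop u n y B ∧ CloseAverages f C A B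

lemma GoodLoops.swap (h : GoodLoops u x y f C n A B) : GoodLoops u y x f C n B A :=
  ⟨h.2.1, h.1, h.2.2.symm⟩

lemma exists_goodLoops_le (h : UniqueRightSpecial u N x y)
    (hf : ∀ A B, |f (A ++ B) - f A - f B| ≤ C) (hn : N ≤ n) (hG : GoodLoops u x y f C n A B)
    {m : ℕ} (hm : n ≤ m) : ∃ A' B', GoodLoops u x y f C m A' B' ∧ A.length ≤ A'.length ∧
      B.length ≤ B'.length := by
  induction m, hm using Nat.le_induction with
  | base => exact ⟨A, B, hG, le_rfl, le_rfl⟩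
  | succ m hm ih =>
    obtain ⟨A', B', ⟨h1, h2, h3⟩, hA, hB⟩ := ih
    obtain ⟨A'', B'', h1', h2', ⟨rfl, rfl⟩ | ⟨rfl, rfl⟩ | ⟨rfl, rfl⟩⟩ :=
      h.exists_isLoop_succ (hn.trans hm) h1 h2
    · exact ⟨_, _, ⟨h1', h2', h3⟩, hA, hB⟩
    · exact ⟨_, _, ⟨h1', h2', (h3.append hf).1⟩, hA, by rw [List.length_append]; omega⟩
    · exact ⟨_, _, ⟨h1', h2', (h3.append hf).2⟩, by rw [List.length_append]; omega, hB⟩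

lemma exists_goodLoops_lt (h : UniqueRightSpecial u N x y)
    (hf : ∀ A B, |f (A ++ B) - f A - f B| ≤ C) (hn : N ≤ n) (hG : GoodLoops u x y f C n A B) :
    ∃ m A' B', N ≤ m ∧ GoodLoops u x y f C m A' B' ∧ A.length < A'.length ∧
      B.length ≤ B'.length := by
  obtain ⟨A₁, B₁, hG₁, hA₁, hB₁⟩ := h.exists_goodLoops_le hf hn hG (le_max_left n A.length)
  have hn₁ : N ≤ max n A.length := hn.trans (le_max_left _ _)
  rcases hA₁.lt_or_eq with hlt | heq
  · exact ⟨_, A₁, B₁, hn₁, hG₁, hlt, hB₁⟩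
  · obtain ⟨m, hm, hne⟩ := h.exists_length_ne hn₁ hG₁.1 (heq ▸ le_max_right n A.length)
    obtain ⟨A₂, B₂, hG₂, hA₂, hB₂⟩ := h.exists_goodLoops_le hf hn₁ hG₁ hm
    exact ⟨m, A₂, B₂, hn₁.trans hm, hG₂, by have := hne A₂ hG₂.1; omega, hB₁.trans hB₂⟩

lemma exists_long_goodLoops (h : UniqueRightSpecial u N x y)
    (hf : ∀ A B, |f (A ++ B) - f A - f B| ≤ C) (hn : N ≤ n) (hG : GoodLoops u x y f C n A B)
    (L : ℕ) : ∃ m A' B', N ≤ m ∧ GoodLoops u x y f C m A' B' ∧ L ≤ A'.length ∧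
      L ≤ B'.length := by
  induction L with
  | zero => exact ⟨n, A, B, hn, hG, Nat.zero_le _, Nat.zero_le _⟩
  | succ L ih =>
    obtain ⟨m, A₁, B₁, hm, hG₁, hA₁, hB₁⟩ := ih
    obtain ⟨m₂, A₂, B₂, hm₂, hG₂, hA₂, hB₂⟩ := h.exists_goodLoops_lt hf hm hG₁
    obtain ⟨m₃, B₃, A₃, hm₃, hG₃, hB₃, hA₃⟩ := h.swap.exists_goodLoops_lt hf hm₂ hG₂.swap
    exact ⟨m₃, A₃, B₃, hm₃, hG₃.swap, by omega, by omega⟩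

end UniqueRightSpecial

/-- From some position on, `u` is a concatenation of copies of `A` and `B`. -/
def EventuallyConcat (u : ℕ → ℕ) (A B : List ℕ) : Prop :=
  ∃ P : ℕ → Prop, (∃ e, P e) ∧ ∀ e, P e →
    (seqBlock u e A.length = A ∧ P (e + A.length)) ∨ (seqBlock u e B.length = B ∧ P (e + B.length))

lemma UniqueRightSpecial.exists_eventuallyConcat {u : ℕ → ℕ} {N x y : ℕ}
    (h : UniqueRightSpecial u N x y) {f : List ℕ → ℝ} {C : ℝ}
    (hf : ∀ A B, |f (A ++ B) - f A - f B| ≤ C) :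
    ∃ C', ∀ L : ℕ, ∃ A B, EventuallyConcat u A B ∧ L ≤ A.length ∧ L ≤ B.length ∧
      CloseAverages f C' A B := by
  obtain ⟨A, hA⟩ := h.exists_isLoop le_rfl
  obtain ⟨B, hB⟩ := h.swap.exists_isLoop le_rfl
  set D := |f A * B.length - f B * A.length| with hD
  have hD0 : 0 ≤ D := abs_nonneg _
  have hC0 : 0 ≤ C := (abs_nonneg _).trans (hf [] [])
  refine ⟨C + D, fun L => ?_⟩
  have hf' : ∀ A B, |f (A ++ B) - f A - f B| ≤ C + D := fun A B => (hf A B).trans (by linarith)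
  have hclose : CloseAverages f (C + D) A B := by
    have ha : (1 : ℝ) ≤ A.length := by exact_mod_cast List.length_pos_iff.2 hA.1
    have hb : (0 : ℝ) ≤ B.length := Nat.cast_nonneg _
    unfold CloseAverages
    rw [← hD]
    nlinarith [mul_nonneg hC0 (by linarith : (0 : ℝ) ≤ A.length + B.length),
      mul_nonneg hD0 (by linarith : (0 : ℝ) ≤ A.length + B.length - 1)]
  obtain ⟨m, A', B', hm, ⟨hA', hB', hc⟩, hLA, hLB⟩ :=
    h.exists_long_goodLoops hf' le_rfl ⟨hA, hB, hclose⟩ L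
  refine ⟨A', B', ⟨RightSpecialAt u m, ?_, fun e he => ?_⟩, hLA, hLB, hc⟩
  · obtain ⟨e, -, he, -⟩ := h.exists_left m hm 0
    exact ⟨e, he⟩
  · rcases h.letter m hm e he with hx | hy
    · exact Or.inl (hA'.2 e he hx)
    · exact Or.inr (hB'.2 e he hy)

lemma exists_eventuallyConcat_of_periodic {u : ℕ → ℕ} {i j : ℕ} (hij : i < j)
    (h : ∀ d, u (i + d) = u (j + d)) (L : ℕ) :
    ∃ A, EventuallyConcat u A A ∧ L ≤ A.length := by
  obtain ⟨s, rfl⟩ := Nat.exists_eq_add_of_lt hij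
  have hper : ∀ t d, u (i + (s + 1) * t + d) = u (i + d) := by
    intro t
    induction t with
    | zero => simp
    | succ t ih =>
      intro d
      have h1 := ih (s + 1 + d)
      have h2 := h d
      rw [h2, show i + s + 1 + d = i + (s + 1 + d) by ring, ← h1]
      congr 1
      ring
  refine ⟨seqBlock u i ((s + 1) * L), ⟨fun e => ∃ t, e = i + (s + 1) * t, ⟨i, 0, by simp⟩, ?_⟩, ?_⟩
  · rintro e ⟨t, rfl⟩
    left
    rw [length_seqBlock]
    exact ⟨seqBlock_eq_iff.2 fun d _ => hper t d, t + L, by ring⟩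
  · rw [length_seqBlock]
    nlinarith

/-! ### Convergence of averages -/

lemma exists_tendsto_of_forall_eventually_close {g : ℕ → ℝ}
    (h : ∀ ε > 0, ∃ l : ℝ, ∀ᶠ m in atTop, |g m - l| ≤ ε) :
    ∃ l, Tendsto g atTop (nhds l) := by
  refine cauchySeq_tendsto_of_complete (Metric.cauchySeq_iff'.2 fun ε hε => ?_)
  obtain ⟨l, hl⟩ := h (ε / 3) (by positivity)
  obtain ⟨M, hM⟩ := eventually_atTop.1 hl
  refine ⟨M, fun n hn => ?_⟩
  have h1 := abs_le.1 (hM n hn)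
  have h2 := abs_le.1 (hM M le_rfl)
  rw [Real.dist_eq, abs_lt]
  constructor <;> linarith

section Averages

variable {u : ℕ → ℕ} {f : List ℕ → ℝ} {C : ℝ}

lemma abs_seqBlock_le (hf : ∀ A B, |f (A ++ B) - f A - f B| ≤ C) (hu : ∀ i, |f [u i]| ≤ C)
    (i n : ℕ) : |f (seqBlock u i n)| ≤ C + 2 * C * n := by
  induction n with
  | zero =>
    have := hf [] []
    simpa [seqBlock] using this
  | succ n ih =>
    have h1 := hf (seqBlock u i n) [u (i + n)]
    rw [seqBlock_add, seqBlock_one]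
    have h2 := hu (i + n)
    rw [abs_le] at *
    push_cast
    constructor <;> linarith

lemma EventuallyConcat.abs_sub_le {A B : List ℕ} (h : EventuallyConcat u A B)
    (hf : ∀ A B, |f (A ++ B) - f A - f B| ≤ C) (hu : ∀ i, |f [u i]| ≤ C) (hA : A ≠ [])
    (hB : B ≠ []) {l ε : ℝ} (hε : 0 ≤ ε) (hlA : |f A - l * A.length| + C ≤ ε * A.length)
    (hlB : |f B - l * B.length| + C ≤ ε * B.length) :
    ∃ K, ∀ᶠ m : ℕ in atTop, |f (seqBlock u 0 m) - l * m| ≤ ε * m + K := by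
  obtain ⟨P, ⟨e, he⟩, hP⟩ := h
  have ha : 0 < A.length := List.length_pos_iff.2 hA
  have hb : 0 < B.length := List.length_pos_iff.2 hB
  have hC : 0 ≤ C := (abs_nonneg _).trans (hf [] [])
  have key : ∀ m, ∃ t, t ≤ m ∧ m < t + (A.length + B.length) ∧ P (e + t) ∧
      |f (seqBlock u e t) - l * t| ≤ ε * t + C := by
    intro m
    induction m with
    | zero =>
      refine ⟨0, le_rfl, by omega, he, ?_⟩
      simpa using abs_seqBlock_le hf hu e 0
    | succ m ih =>
      obtain ⟨t, ht, hmt, hPt, hft⟩ := ih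
      by_cases hlt : m + 1 < t + (A.length + B.length)
      · exact ⟨t, by omega, hlt, hPt, hft⟩
      have step : ∀ L : List ℕ, seqBlock u (e + t) L.length = L →
          |f L - l * L.length| + C ≤ ε * L.length →
          |f (seqBlock u e (t + L.length)) - l * (t + L.length : ℕ)| ≤
            ε * (t + L.length : ℕ) + C := by
        intro L hL hlL
        have h1 := abs_le.1 (hf (seqBlock u e t) L)
        have h2 := abs_le.1 (le_sub_iff_add_le.2 hlL)
        have h3 := abs_le.1 hft
        rw [seqBlock_add, hL, abs_le]
        push_cast
        constructor <;> linarith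
      rcases hP _ hPt with ⟨h1, h2⟩ | ⟨h1, h2⟩
      · exact ⟨t + A.length, by omega, by omega, by rwa [← add_assoc], step A h1 hlA⟩
      · exact ⟨t + B.length, by omega, by omega, by rwa [← add_assoc], step B h1 hlB⟩
  set S : ℝ := A.length + B.length with hS
  refine ⟨|f (seqBlock u 0 e)| + |l| * e + 3 * C + |l| * S + (C + 2 * C * S), ?_⟩
  filter_upwards [eventually_ge_atTop e] with m hm
  obtain ⟨t, ht, hmt, -, hft⟩ := key (m - e)
  obtain ⟨r, hr⟩ := Nat.exists_eq_add_of_le ht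
  have hmr : m = e + t + r := by omega
  have hrS : (r : ℝ) ≤ S := by
    have : r ≤ A.length + B.length := by omega
    rw [hS]
    exact_mod_cast this
  have h1 := abs_le.1 (hf (seqBlock u 0 (e + t)) (seqBlock u (e + t) r))
  have h2 := abs_le.1 (hf (seqBlock u 0 e) (seqBlock u e t))
  rw [hmr, seqBlock_add u 0 (e + t) r, Nat.zero_add]
  rw [seqBlock_add u 0 e t, Nat.zero_add] at h1 ⊢
  have h3 := abs_le.1 ((abs_seqBlock_le hf hu (e + t) r).trans
    (add_le_add_right (mul_le_mul_of_nonneg_left hrS (by linarith : 0 ≤ 2 * C)) C))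
  have h4 := abs_le.1 hft
  have h5 := abs_le.1 (le_refl |f (seqBlock u 0 e)|)
  have h6 := abs_le.1 (le_refl |l|)
  have he0 : (0 : ℝ) ≤ e := Nat.cast_nonneg _
  have hr0 : (0 : ℝ) ≤ r := Nat.cast_nonneg _
  have h7 := mul_le_mul_of_nonneg_right h6.1 he0
  have h8 := mul_le_mul_of_nonneg_right h6.2 he0
  have h9 := mul_le_mul_of_nonneg_right h6.1 hr0
  have h10 := mul_le_mul_of_nonneg_right h6.2 hr0
  have h11 := mul_le_mul_of_nonneg_left hrS (abs_nonneg l)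
  have h12 := mul_nonneg hε he0
  have h13 := mul_nonneg hε hr0
  push_cast
  rw [abs_le]
  constructor <;> nlinarith

lemma exists_tendsto_of_eventuallyConcat (hf : ∀ A B, |f (A ++ B) - f A - f B| ≤ C)
    (hu : ∀ i, |f [u i]| ≤ C) (C' : ℝ) (h : ∀ L : ℕ, ∃ A B, EventuallyConcat u A B ∧
      L ≤ A.length ∧ L ≤ B.length ∧ CloseAverages f C' A B) :
    ∃ l, Tendsto (fun n : ℕ => f (seqBlock u 0 n) / n) atTop (nhds l) := by
  have hC : 0 ≤ C := (abs_nonneg _).trans (hf [] [])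
  refine exists_tendsto_of_forall_eventually_close fun ε hε => ?_
  obtain ⟨L, hL⟩ := exists_nat_gt (2 * (2 * |C'| + C) / ε + 1)
  obtain ⟨A, B, hAB, hA, hB, hc⟩ := h L
  have hAL : (L : ℝ) ≤ A.length := by exact_mod_cast hA
  have hBL : (L : ℝ) ≤ B.length := by exact_mod_cast hB
  have hL1 : (1 : ℝ) < L := lt_of_le_of_lt (le_add_of_nonneg_left (by positivity)) hL
  have hLε : 2 * |C'| + C ≤ ε / 2 * L := by
    have : 2 * (2 * |C'| + C) / ε < L := by linarith
    rw [div_lt_iff₀ hε] at this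
    linarith
  have ha : (0 : ℝ) < A.length := by linarith
  have hb : (0 : ℝ) < B.length := by linarith
  set l : ℝ := f A / A.length with hl
  have hlA : f A = l * A.length := by rw [hl]; field_simp
  have hclose : |f B - l * B.length| ≤ |C'| + |C'| * B.length / A.length := by
    have h1 : |f B - l * B.length| = |f A * B.length - f B * A.length| / A.length := by
      rw [eq_div_iff ha.ne', ← abs_of_pos ha, ← abs_mul, abs_sub_comm, abs_of_pos ha, hlA]
      congr 1
      ring
    rw [h1, div_le_iff₀ ha]
    refine hc.trans ((mul_le_mul_of_nonneg_right (le_abs_self C') (by positivity)).trans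
      (le_of_eq ?_))
    field_simp
  obtain ⟨K, hK⟩ := hAB.abs_sub_le hf hu (l := l) (ε := ε / 2)
    (List.length_pos_iff.1 (by exact_mod_cast ha)) (List.length_pos_iff.1 (by exact_mod_cast hb))
    (by positivity) (by
      rw [hlA, sub_self, abs_zero]
      nlinarith [abs_nonneg C']) (by
      have h2 : |C'| * B.length / A.length ≤ |C'| * B.length / L := by gcongr
      have h3 : (2 * |C'| + C) * B.length / L ≤ ε / 2 * B.length := by
        rw [div_le_iff₀ (by linarith)]
        nlinarith
      have h4 : |C'| + C ≤ (|C'| + C) * B.length / L := by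
        rw [le_div_iff₀ (by linarith)]
        exact mul_le_mul_of_nonneg_left hBL (by positivity)
      have h5 : (2 * |C'| + C) * B.length / L =
          (|C'| + C) * B.length / L + |C'| * B.length / L := by ring
      linarith)
  refine ⟨l, ?_⟩
  have hlarge : ∀ᶠ m : ℕ in atTop, K / (ε / 2) < (m : ℝ) :=
    tendsto_natCast_atTop_atTop.eventually_gt_atTop _
  filter_upwards [hK, hlarge, eventually_gt_atTop 0] with m h1 h2 h3
  have hm : (0 : ℝ) < m := by exact_mod_cast h3
  rw [div_lt_iff₀ (by positivity)] at h2
  rw [div_sub' hm.ne', abs_div, abs_of_pos hm, div_le_iff₀ hm, mul_comm (m : ℝ) l]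
  linarith

end Averages

/-! ### Complexity and right special factors -/

/-- The factors of length `n` of a sequence. -/
def factorSet (u : ℕ → ℕ) (n : ℕ) : Set (List ℕ) := Set.range fun i => seqBlock u i n

lemma complexity_eq_ncard (w : ℕ → ℕ) (n : ℕ) :
    complexity w n = (factorSet (fun i => w (i + 1)) n).ncard := by
  unfold complexity
  congr 1
  ext L
  constructor
  · rintro ⟨rfl, i, hi⟩
    exact ⟨i, hi.symm⟩
  · rintro ⟨i, rfl⟩
    refine ⟨length_seqBlock _ _ _, i, ?_⟩
    rw [length_seqBlock]
    rfl

section Factors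

variable {u : ℕ → ℕ}

lemma finite_factorSet {M : ℕ} (hM : ∀ i, u i ≤ M) (n : ℕ) : (factorSet u n).Finite := by
  induction n with
  | zero => exact (Set.finite_singleton []).subset (by rintro _ ⟨i, rfl⟩; simp [seqBlock])
  | succ n ih =>
    refine (ih.image2 (fun L c => L ++ [c]) (Set.finite_Iic M)).subset ?_
    rintro _ ⟨i, rfl⟩
    refine ⟨_, ⟨i, rfl⟩, u (i + n), hM _, ?_⟩
    simp only [seqBlock_add, seqBlock_one]

/-- Removing factors of length `n + 1` without losing their prefixes bounds the complexity. -/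
lemma ncard_add_le (hfin : ∀ n, (factorSet u n).Finite) {n : ℕ} {S : Set (List ℕ)}
    (hS : S ⊆ factorSet u (n + 1))
    (h : ∀ i, seqBlock u i (n + 1) ∈ S → ∃ j, seqBlock u j (n + 1) ∉ S ∧
      seqBlock u j n = seqBlock u i n) :
    (factorSet u n).ncard + S.ncard ≤ (factorSet u (n + 1)).ncard := by
  have hsub : factorSet u n ⊆ List.take n '' (factorSet u (n + 1) \ S) := by
    rintro _ ⟨i, rfl⟩
    have htake : ∀ j, List.take n (seqBlock u j (n + 1)) = seqBlock u j n := fun j => by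
      rw [seqBlock_add, List.take_left' (length_seqBlock _ _ _)]
    by_cases hi : seqBlock u i (n + 1) ∈ S
    · obtain ⟨j, hj, hji⟩ := h i hi
      exact ⟨_, ⟨⟨j, rfl⟩, hj⟩, (htake j).trans hji⟩
    · exact ⟨_, ⟨⟨i, rfl⟩, hi⟩, htake i⟩
  have h1 := (Set.ncard_le_ncard hsub ((hfin _).sdiff.image _)).trans
    (Set.ncard_image_le (hfin _).sdiff)
  have h2 := Set.ncard_sdiff_add_ncard_of_subset hS (hfin _)
  omega

lemma seqBlock_succ_eq_iff {i j n : ℕ} : seqBlock u i (n + 1) = seqBlock u j (n + 1) ↔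
    seqBlock u i n = seqBlock u j n ∧ u (i + n) = u (j + n) := by
  simp only [seqBlock_eq_iff, Nat.lt_succ_iff_lt_or_eq, or_imp, forall_and, forall_eq]

lemma ncard_lt_of_rightSpecial (hfin : ∀ n, (factorSet u n).Finite) {n i j : ℕ}
    (hij : seqBlock u i n = seqBlock u j n) (hne : u (i + n) ≠ u (j + n)) :
    (factorSet u n).ncard + 1 ≤ (factorSet u (n + 1)).ncard := by
  have := ncard_add_le hfin (n := n) (S := {seqBlock u i (n + 1)})
    (by rintro _ rfl; exact ⟨i, rfl⟩) (by
      intro a ha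
      refine ⟨j, fun hj => hne (seqBlock_succ_eq_iff.1 hj).2.symm, ?_⟩
      rw [← hij]
      exact (seqBlock_succ_eq_iff.1 ha).1.symm)
  simpa using this

lemma eq_or_eq_of_ncard_le (hfin : ∀ n, (factorSet u n).Finite) {n : ℕ}
    (hn : (factorSet u (n + 1)).ncard ≤ (factorSet u n).ncard + 1) {i j a b : ℕ}
    (hij : seqBlock u i n = seqBlock u j n) (hne : u (i + n) ≠ u (j + n))
    (hab : seqBlock u a n = seqBlock u b n) (hne' : u (a + n) ≠ u (b + n)) :
    seqBlock u a (n + 1) = seqBlock u i (n + 1) ∨ seqBlock u a (n + 1) = seqBlock u j (n + 1) := by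
  by_contra! hcon
  obtain ⟨h1, h2⟩ := hcon
  have hcard := ncard_add_le hfin (n := n)
    (S := {seqBlock u a (n + 1), seqBlock u i (n + 1)})
    (by rintro _ (rfl | rfl) <;> exact ⟨_, rfl⟩) (by
      have hj : seqBlock u j (n + 1) ∉
          ({seqBlock u a (n + 1), seqBlock u i (n + 1)} : Set (List ℕ)) := by
        rintro (h | h)
        · exact h2 h.symm
        · exact hne (seqBlock_succ_eq_iff.1 h).2.symm
      rintro c (hc | hc)
      · by_cases hbi : seqBlock u b (n + 1) = seqBlock u i (n + 1)
        · refine ⟨j, hj, ?_⟩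
          rw [(seqBlock_succ_eq_iff.1 hc).1, hab, (seqBlock_succ_eq_iff.1 hbi).1, hij]
        · refine ⟨b, ?_, ?_⟩
          · rintro (h | h)
            · exact hne' (seqBlock_succ_eq_iff.1 h).2.symm
            · exact hbi h
          · rw [(seqBlock_succ_eq_iff.1 hc).1, hab]
      · exact ⟨j, hj, by rw [(seqBlock_succ_eq_iff.1 hc).1, hij]⟩)
  rw [Set.ncard_pair h1] at hcard
  omega

lemma exists_samePast_ne (hfin : ∀ n, (factorSet u n).Finite)
    (hap : ∀ i j, i ≠ j → ∃ d, u (i + d) ≠ u (j + d)) (n M : ℕ) :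
    ∃ e e', M < e ∧ M < e' ∧ SamePast u n e e' ∧ u e ≠ u e' := by
  obtain ⟨i, hi, j, hj, hij, heq⟩ := Set.infinite_univ.exists_ne_map_eq_of_mapsTo
    (f := fun i => seqBlock u (M + 1 + i) n) (t := factorSet u n) (s := Set.univ)
    (fun i _ => ⟨_, rfl⟩) (hfin n)
  have h0 : SamePast u 0 (M + 1 + i) (M + 1 + j) := ⟨by omega, by omega, by simp⟩
  obtain ⟨d, -, h2, h3⟩ := exists_first_difference hap (h0.extend (seqBlock_eq_iff.1 heq))
    (by omega)
  exact ⟨_, _, by omega, by omega, h2.mono (by omega), h3⟩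

lemma exists_uniqueRightSpecial {k : ℕ} (hfin : ∀ n, (factorSet u n).Finite)
    (hap : ∀ i j, i ≠ j → ∃ d, u (i + d) ≠ u (j + d))
    (hk : ∀ n, 1 ≤ n → (factorSet u n).ncard ≤ n + k) :
    ∃ N x y, UniqueRightSpecial u N x y := by
  have hblock : ∀ {n e e'}, SamePast u n e e' → seqBlock u (e - n) n = seqBlock u (e' - n) n :=
    fun h => seqBlock_eq_iff.2 h.block_eq
  have hlast : ∀ {n e}, n ≤ e → u (e - n + n) = u e := fun h => by rw [Nat.sub_add_cancel h]
  have hstrict : ∀ n, (factorSet u n).ncard + 1 ≤ (factorSet u (n + 1)).ncard := by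
    intro n
    obtain ⟨e, e', -, -, hs, hne⟩ := exists_samePast_ne hfin hap n 0
    exact ncard_lt_of_rightSpecial hfin (hblock hs) (by rwa [hlast hs.1, hlast hs.2.1])
  obtain ⟨N, hN⟩ : ∃ N, ∀ n, N ≤ n →
      (factorSet u (n + 1)).ncard ≤ (factorSet u n).ncard + 1 := by
    by_contra! hcon
    have hmono : ∀ n m, (factorSet u n).ncard + m ≤ (factorSet u (n + m)).ncard := by
      intro n m
      induction m with
      | zero => simp
      | succ m ih =>
        have := hstrict (n + m)
        rw [← Nat.add_assoc n m 1]
        omega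
    have hbig : ∀ K, ∃ n, n + K ≤ (factorSet u n).ncard := by
      intro K
      induction K with
      | zero => exact ⟨0, by simp⟩
      | succ K ih =>
        obtain ⟨n, hn⟩ := ih
        obtain ⟨m, hm, hlt⟩ := hcon n
        have := hmono n (m - n)
        rw [Nat.add_sub_cancel' hm] at this
        exact ⟨m + 1, by omega⟩
    obtain ⟨n, hn⟩ := hbig (k + 1)
    have h1 := hstrict n
    have h2 := hk (n + 1) (by omega)
    omega
  obtain ⟨e₀, e₁, -, -, hs₀, hne₀⟩ := exists_samePast_ne hfin hap N 0
  have huniq : ∀ n, N ≤ n → ∀ e e' g, SamePast u n e e' → u e ≠ u e' → RightSpecialAt u n g →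
      SamePast u n e g ∧ (u g = u e ∨ u g = u e') := by
    rintro n hn e e' g hs hne ⟨g', hg, hgne⟩
    have conv : ∀ {c}, n ≤ c → seqBlock u (g - n) (n + 1) = seqBlock u (c - n) (n + 1) →
        SamePast u n c g ∧ u g = u c := by
      intro c hc heq
      obtain ⟨h1, h2⟩ := seqBlock_succ_eq_iff.1 heq
      rw [hlast hg.1, hlast hc] at h2
      have h0 : SamePast u 0 (g - n) (c - n) := ⟨by omega, by omega, by simp⟩
      have := h0.extend (seqBlock_eq_iff.1 h1)
      rw [Nat.sub_add_cancel hg.1, Nat.sub_add_cancel hc, Nat.zero_add] at this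
      exact ⟨this.symm, h2⟩
    rcases eq_or_eq_of_ncard_le hfin (hN n hn) (hblock hs)
      (by rwa [hlast hs.1, hlast hs.2.1]) (hblock hg) (by rwa [hlast hg.1, hlast hg.2.1])
      with h | h
    · exact ⟨(conv hs.1 h).1, Or.inl (conv hs.1 h).2⟩
    · exact ⟨hs.trans (conv hs.2.1 h).1, Or.inr (conv hs.2.1 h).2⟩
  have hletter : ∀ n, N ≤ n → ∀ e, RightSpecialAt u n e → u e = u e₀ ∨ u e = u e₁ :=
    fun n hn e he => (huniq N le_rfl e₀ e₁ e hs₀ hne₀ (he.mono hn)).2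
  have hboth : ∀ n, N ≤ n → ∀ M, (∃ e, M < e ∧ RightSpecialAt u n e ∧ u e = u e₀) ∧
      ∃ e, M < e ∧ RightSpecialAt u n e ∧ u e = u e₁ := by
    intro n hn M
    obtain ⟨e, e', he, he', hs, hne⟩ := exists_samePast_ne hfin hap n M
    have hr : RightSpecialAt u n e := ⟨e', hs, hne⟩
    have hr' : RightSpecialAt u n e' := ⟨e, hs.symm, hne.symm⟩
    rcases hletter n hn e hr with h1 | h1 <;> rcases hletter n hn e' hr' with h2 | h2
    · exact absurd (h1.trans h2.symm) hne
    · exact ⟨⟨e, he, hr, h1⟩, e', he', hr', h2⟩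
    · exact ⟨⟨e', he', hr', h2⟩, e, he, hr, h1⟩
    · exact absurd (h1.trans h2.symm) hne
  exact ⟨N, u e₀, u e₁, hap, hne₀,
    fun n hn e g ⟨e', hs, hne⟩ hg => (huniq n hn e e' g hs hne hg).1, hletter,
    fun n hn M => (hboth n hn M).1, fun n hn M => (hboth n hn M).2⟩

/-- Averages of an almost additive function along a sequence of complexity at most `n + k`
converge. -/
theorem exists_tendsto_average_of_ncard_le {k M : ℕ} (hM : ∀ i, u i ≤ M)
    (hk : ∀ n, 1 ≤ n → (factorSet u n).ncard ≤ n + k) {f : List ℕ → ℝ} {C : ℝ}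
    (hf : ∀ A B, |f (A ++ B) - f A - f B| ≤ C) (hu : ∀ i, |f [u i]| ≤ C) :
    ∃ l, Tendsto (fun n : ℕ => f (seqBlock u 0 n) / n) atTop (nhds l) := by
  by_cases hap : ∀ i j, i ≠ j → ∃ d, u (i + d) ≠ u (j + d)
  · obtain ⟨N, x, y, h⟩ := exists_uniqueRightSpecial (finite_factorSet hM) hap hk
    obtain ⟨C', hC'⟩ := h.exists_eventuallyConcat hf
    exact exists_tendsto_of_eventuallyConcat hf hu C' hC'
  · push Not at hap
    obtain ⟨i, j, hij, h⟩ := hap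
    obtain ⟨i, j, hij, h⟩ : ∃ i j, i < j ∧ ∀ d, u (i + d) = u (j + d) := by
      rcases hij.lt_or_gt with hlt | hlt
      · exact ⟨i, j, hlt, h⟩
      · exact ⟨j, i, hlt, fun d => (h d).symm⟩
    refine exists_tendsto_of_eventuallyConcat hf hu 0 fun L => ?_
    obtain ⟨A, hA, hL⟩ := exists_eventuallyConcat_of_periodic hij h L
    exact ⟨A, A, hA, hL, hL, by simp [CloseAverages]⟩

end Factors

/-! ### Continuants -/

/-- The product of the matrices `[[c, 1], [1, 0]]` over a word, where the letter `0` is read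
as `1`. -/
def contMat (A : List ℕ) : Matrix (Fin 2) (Fin 2) ℕ :=
  (A.map fun c => !![max c 1, 1; 1, 0]).prod

lemma contMat_append (A B : List ℕ) : contMat (A ++ B) = contMat A * contMat B := by
  simp [contMat]

lemma contMat_bounds (A : List ℕ) : 1 ≤ contMat A 0 0 ∧ contMat A 0 1 ≤ contMat A 0 0 ∧
    contMat A 1 0 ≤ contMat A 0 0 ∧
    contMat A 0 1 + contMat A 1 1 ≤ contMat A 0 0 + contMat A 1 0 := by
  induction A with
  | nil => simp [contMat]
  | cons c A ih =>
    have hcons : contMat (c :: A) = !![max c 1, 1; 1, 0] * contMat A := by simp [contMat]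
    have hc : 1 ≤ max c 1 := le_max_right _ _
    obtain ⟨h1, h2, h3, h4⟩ := ih
    rw [hcons]
    simp only [Matrix.mul_apply, Fin.sum_univ_two, Matrix.of_apply, Matrix.cons_val',
      Matrix.cons_val_zero, Matrix.cons_val_one, Matrix.cons_val_fin_one, one_mul, zero_mul, add_zero]
    generalize max c 1 = c at hc
    obtain ⟨c, rfl⟩ := Nat.exists_eq_add_of_le hc
    refine ⟨?_, ?_, ?_, ?_⟩ <;> nlinarith

lemma contMat_append_bounds (A B : List ℕ) :
    contMat A 0 0 * contMat B 0 0 ≤ contMat (A ++ B) 0 0 ∧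
      contMat (A ++ B) 0 0 ≤ 2 * (contMat A 0 0 * contMat B 0 0) := by
  have hA := contMat_bounds A
  have hB := contMat_bounds B
  have h := Nat.mul_le_mul hA.2.1 hB.2.2.1
  rw [contMat_append, Matrix.mul_apply, Fin.sum_univ_two]
  omega

lemma abs_log_contMat_append_le (A B : List ℕ) :
    |Real.log (contMat (A ++ B) 0 0) - Real.log (contMat A 0 0) - Real.log (contMat B 0 0)| ≤
      Real.log 2 := by
  have hA : (0 : ℝ) < contMat A 0 0 := by exact_mod_cast (contMat_bounds A).1
  have hB : (0 : ℝ) < contMat B 0 0 := by exact_mod_cast (contMat_bounds B).1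
  obtain ⟨h1, h2⟩ := contMat_append_bounds A B
  have h1' : (contMat A 0 0 * contMat B 0 0 : ℝ) ≤ contMat (A ++ B) 0 0 := by exact_mod_cast h1
  have h2' : (contMat (A ++ B) 0 0 : ℝ) ≤ 2 * (contMat A 0 0 * contMat B 0 0) := by
    exact_mod_cast h2
  have l1 := Real.log_le_log (by positivity) h1'
  have l2 := Real.log_le_log (lt_of_lt_of_le (by positivity) h1') h2'
  rw [Real.log_mul hA.ne' hB.ne'] at l1
  rw [Real.log_mul two_ne_zero (by positivity), Real.log_mul hA.ne' hB.ne'] at l2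
  have := Real.log_nonneg one_le_two
  rw [abs_le]
  constructor <;> linarith

lemma contQ_eq_contMat {w : ℕ → ℕ} (hpos : ∀ n, 1 ≤ n → 0 < w n) (n : ℕ) :
    contQ w n = contMat (seqBlock (fun i => w (i + 1)) 0 n) 0 0 := by
  set u : ℕ → ℕ := fun i => w (i + 1) with hu
  have hstep : ∀ n, contMat (seqBlock u 0 (n + 1)) 0 0 =
      contMat (seqBlock u 0 n) 0 0 * w (n + 1) + contMat (seqBlock u 0 n) 0 1 ∧
      contMat (seqBlock u 0 (n + 1)) 0 1 = contMat (seqBlock u 0 n) 0 0 := by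
    intro n
    have hw : max (w (n + 1)) 1 = w (n + 1) := max_eq_left (hpos _ (by omega))
    rw [seqBlock_add, seqBlock_one, contMat_append]
    simp [contMat, Matrix.mul_apply, Fin.sum_univ_two, hu, hw]
  induction n using Nat.twoStepInduction with
  | zero => simp [contQ, seqBlock, contMat]
  | one =>
    rw [(hstep 0).1]
    simp [contQ, seqBlock, contMat]
  | more n h1 h2 =>
    rw [(hstep (n + 1)).1, (hstep n).2, contQ, h1, h2]
    ring

/-- If `w` is a bounded infinite word over the positive integers whose
complexity satisfies `p(n, w) ≤ n + k` for all `n ≥ 1` (for some positive integer `k`),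
then `[0; w 1, w 2, …]` has a Lévy constant. -/
theorem stmt0 (w : ℕ → ℕ) (hpos : ∀ n, 1 ≤ n → 0 < w n) (hbdd : ∃ B, ∀ n, w n ≤ B)
    (k : ℕ) (hk : 0 < k) (hcomp : ∀ n, 1 ≤ n → complexity w n ≤ n + k) :
    ∃ ℓ : ℝ, HasLevyConstant w ℓ := by
  obtain ⟨M, hM⟩ := hbdd
  unfold HasLevyConstant
  simp only [contQ_eq_contMat hpos]
  have h2M : (2 : ℝ) ≤ M + 2 := by linarith [Nat.cast_nonneg (α := ℝ) M]
  refine exists_tendsto_average_of_ncard_le (f := fun A => Real.log (contMat A 0 0))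
    (C := Real.log (M + 2)) (fun i => hM (i + 1))
    (fun n hn => complexity_eq_ncard w n ▸ hcomp n hn)
    (fun A B => (abs_log_contMat_append_le A B).trans (Real.log_le_log two_pos h2M)) fun i => ?_
  have h1 : (1 : ℝ) ≤ (max (w (i + 1)) 1 : ℕ) := by exact_mod_cast le_max_right _ _
  have h2 : ((max (w (i + 1)) 1 : ℕ) : ℝ) ≤ M + 2 := by
    have : max (w (i + 1)) 1 ≤ M + 2 := max_le ((hM _).trans (by omega)) (by omega)
    exact_mod_cast this
  simp only [contMat, List.map_cons, List.map_nil, List.prod_cons, List.prod_nil, mul_one,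
    Matrix.of_apply, Matrix.cons_val', Matrix.cons_val_zero, Matrix.cons_val_fin_one]
  rw [abs_of_nonneg (Real.log_nonneg h1)]
  exact Real.log_le_log (by linarith) h2
end

section
/- Let a, b be integers with 1 ≤ a < b. The set of Lévy constants L([0; s_{θ,0}]) as θ ranges over [0,1], where s_{θ,0} is the mechanical word over {a,b} with slope θ and intercept 0, is equal to the whole closed interval [L([0; a, a, a, ...]), L([0; b, b, b, ...])], where [0; a, a, a, ...] and [0; b, b, b, ...] denote the purely periodic continued fractions with all partial quotients equal to a, respectively b. -/
open Filter Real Matrix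

lemma contQ_pos {w : ℕ → ℕ} (hw : ∀ n, 1 ≤ w n) (n : ℕ) : 1 ≤ contQ w n := by
  induction n using Nat.strong_induction_on with
  | _ n ih =>
    match n, ih with
    | 0, _ => simp [contQ]
    | 1, _ => simpa [contQ] using hw 1
    | n + 2, ih =>
      have := ih n (by omega)
      simp only [contQ]
      omega

lemma contQ_le_succ {w : ℕ → ℕ} (hw : ∀ n, 1 ≤ w n) (n : ℕ) :
    contQ w n ≤ contQ w (n + 1) := by
  match n with
  | 0 => simpa [contQ] using hw 1
  | n + 1 =>
    have := Nat.mul_le_mul_right (contQ w (n + 1)) (hw (n + 2))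
    simp only [contQ]
    omega

lemma contQ_mono {w w' : ℕ → ℕ} (h : ∀ n, w n ≤ w' n) (n : ℕ) : contQ w n ≤ contQ w' n := by
  induction n using Nat.strong_induction_on with
  | _ n ih =>
    match n, ih with
    | 0, _ => simp [contQ]
    | 1, _ => simpa [contQ] using h 1
    | n + 2, ih =>
      have := Nat.mul_le_mul (h (n + 2)) (ih (n + 1) (by omega))
      have := ih n (by omega)
      simp only [contQ]
      omega

lemma contQ_congr {w w' : ℕ → ℕ} {n : ℕ} (h : ∀ j, 1 ≤ j → j ≤ n → w j = w' j) :
    contQ w n = contQ w' n := by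
  induction n using Nat.strong_induction_on with
  | _ n ih =>
    match n, ih, h with
    | 0, _, _ => simp [contQ]
    | 1, _, h => simpa [contQ] using h 1
    | n + 2, ih, h =>
      simp only [contQ]
      rw [ih (n + 1) (by omega) fun j h1 h2 => h j h1 (by omega),
        ih n (by omega) fun j h1 h2 => h j h1 (by omega), h (n + 2) (by omega) le_rfl]

lemma contQ_le_pow {w : ℕ → ℕ} {b : ℕ} (hw : ∀ n, w n ≤ b) (n : ℕ) :
    contQ w n ≤ (b + 1) ^ n := by
  induction n using Nat.strong_induction_on with
  | _ n ih =>
    match n, ih with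
    | 0, _ => simp [contQ]
    | 1, _ => simpa [contQ] using (hw 1).trans (Nat.le_succ b)
    | n + 2, ih =>
      calc contQ w (n + 2) = w (n + 2) * contQ w (n + 1) + contQ w n := rfl
        _ ≤ b * (b + 1) ^ (n + 1) + (b + 1) ^ (n + 1) :=
          add_le_add (Nat.mul_le_mul (hw _) (ih _ (by omega)))
            ((ih n (by omega)).trans (Nat.pow_le_pow_right (by omega) (by omega)))
        _ = (b + 1) ^ (n + 2) := by ring

/-- Continuants are super-multiplicative, and sub-multiplicative up to a factor `2`. -/
lemma contQ_add_bounds {w : ℕ → ℕ} (hw : ∀ n, 1 ≤ w n) (n m : ℕ) :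
    contQ w n * contQ (fun j => w (n + j)) m ≤ contQ w (n + m) ∧
      contQ w (n + m) ≤ 2 * (contQ w n * contQ (fun j => w (n + j)) m) := by
  induction m using Nat.strong_induction_on with
  | _ m ih =>
    match m, ih with
    | 0, _ => simp only [contQ, add_zero]; omega
    | 1, _ =>
      match n with
      | 0 => simp only [contQ, zero_add]; omega
      | n + 1 =>
        have h1 := contQ_le_succ hw n
        have h2 := Nat.mul_le_mul_right (contQ w (n + 1)) (hw (n + 2))
        have h3 : contQ w (n + 1 + 1) = w (n + 2) * contQ w (n + 1) + contQ w n := rfl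
        have h4 : contQ (fun j => w (n + 1 + j)) 1 = w (n + 2) := rfl
        rw [h3, h4, mul_comm (contQ w (n + 1))]
        omega
    | m + 2, ih =>
      obtain ⟨h1, h2⟩ := ih m (by omega)
      obtain ⟨h3, h4⟩ := ih (m + 1) (by omega)
      have e1 : contQ w (n + (m + 2)) =
        w (n + (m + 2)) * contQ w (n + (m + 1)) + contQ w (n + m) := rfl
      have e2 : contQ (fun j => w (n + j)) (m + 2) =
        w (n + (m + 2)) * contQ (fun j => w (n + j)) (m + 1) + contQ (fun j => w (n + j)) m := rfl
      have h5 := Nat.mul_le_mul_left (w (n + (m + 2))) h3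
      have h6 := Nat.mul_le_mul_left (w (n + (m + 2))) h4
      rw [e1, e2]
      constructor <;> nlinarith

/-- Changing one partial quotient changes a continuant by a factor of at most `b`. -/
lemma contQ_le_pow_card_mul {w w' : ℕ → ℕ} {b : ℕ} (hw : ∀ n, w n ≤ b) (hw' : ∀ n, 1 ≤ w' n)
    (hb : 1 ≤ b) (n : ℕ) :
    contQ w n ≤ b ^ ((Finset.Icc 1 n).filter fun j => w j ≠ w' j).card * contQ w' n := by
  set d : ℕ → ℕ := fun n => ((Finset.Icc 1 n).filter fun j => w j ≠ w' j).card with hd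
  have hd_mono : Monotone d := fun m n h =>
    Finset.card_le_card (Finset.filter_subset_filter _ (Finset.Icc_subset_Icc_right h))
  have hletter : ∀ n, b ^ d n * w (n + 1) ≤ b ^ d (n + 1) * w' (n + 1) := by
    intro n
    by_cases h : w (n + 1) = w' (n + 1)
    · rw [h]
      exact Nat.mul_le_mul_right _ (Nat.pow_le_pow_right hb (hd_mono n.le_succ))
    · have hs : d (n + 1) = d n + 1 := by
        simp only [hd]
        rw [← Finset.insert_Icc_right_eq_Icc_add_one (by omega), Finset.filter_insert, if_pos h,
          Finset.card_insert_of_notMem (by simp)]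
      rw [hs, pow_succ, mul_assoc]
      exact Nat.mul_le_mul_left _ ((hw _).trans (Nat.le_mul_of_pos_right _ (hw' _)))
  change contQ w n ≤ b ^ d n * contQ w' n
  induction n using Nat.strong_induction_on with
  | _ n ih =>
    match n, ih with
    | 0, _ => simpa [contQ] using Nat.one_le_pow _ _ hb
    | 1, _ => simpa [contQ, hd] using hletter 0
    | n + 2, ih =>
      calc contQ w (n + 2) = w (n + 2) * contQ w (n + 1) + contQ w n := rfl
        _ ≤ w (n + 2) * (b ^ d (n + 1) * contQ w' (n + 1)) + b ^ d n * contQ w' n :=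
          add_le_add (Nat.mul_le_mul_left _ (ih _ (by omega))) (ih _ (by omega))
        _ = (b ^ d (n + 1) * w (n + 2)) * contQ w' (n + 1) + b ^ d n * contQ w' n := by ring
        _ ≤ (b ^ d (n + 2) * w' (n + 2)) * contQ w' (n + 1) + b ^ d (n + 2) * contQ w' n :=
          add_le_add (Nat.mul_le_mul_right _ (hletter _))
            (Nat.mul_le_mul_right _ (Nat.pow_le_pow_right hb (hd_mono (by omega))))
        _ = b ^ d (n + 2) * contQ w' (n + 2) := by simp only [contQ]; ring

lemma one_le_mechWord {a b : ℕ} (ha : 1 ≤ a) (hab : a < b) (θ ρ : ℝ) (n : ℕ) :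
    1 ≤ mechWord a b θ ρ n := by
  unfold mechWord; split_ifs <;> omega

lemma le_mechWord {a b : ℕ} (hab : a < b) (θ ρ : ℝ) (n : ℕ) : a ≤ mechWord a b θ ρ n := by
  unfold mechWord; split_ifs <;> omega

lemma mechWord_le {a b : ℕ} (hab : a < b) (θ ρ : ℝ) (n : ℕ) : mechWord a b θ ρ n ≤ b := by
  unfold mechWord; split_ifs <;> omega

lemma mechWord_shift (a b : ℕ) (θ ρ : ℝ) (n : ℕ) :
    (fun j => mechWord a b θ ρ (n + j)) = mechWord a b θ (ρ + n * θ) := by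
  funext j
  unfold mechWord
  rw [show ((n + j : ℕ) : ℝ) * θ + ρ = j * θ + (ρ + n * θ) by push_cast; ring,
    show (((n + j : ℕ) : ℝ) - 1) * θ + ρ = (j - 1) * θ + (ρ + n * θ) by push_cast; ring]

lemma mechWord_add_int (a b : ℕ) (θ ρ : ℝ) (z : ℤ) :
    mechWord a b θ (ρ + z) = mechWord a b θ ρ := by
  funext j
  unfold mechWord
  simp only [← add_assoc, Int.floor_add_intCast, add_sub_add_right_eq_sub]

lemma mechWord_zero_zero (a b : ℕ) : mechWord a b 0 0 = fun _ => a := by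
  funext n; simp [mechWord]

lemma mechWord_one_zero (a b : ℕ) : mechWord a b 1 0 = fun _ => b := by
  funext n
  unfold mechWord
  rw [if_neg]
  simp

/-- The logarithm of the `n`-th continuant of the mechanical word `s_{θ,ρ}`. -/
noncomputable def logDen (a b : ℕ) (θ : ℝ) (n : ℕ) (ρ : ℝ) : ℝ :=
  Real.log (contQ (mechWord a b θ ρ) n)

lemma logDen_nonneg (a b : ℕ) (θ : ℝ) (n : ℕ) (ρ : ℝ) : 0 ≤ logDen a b θ n ρ :=
  Real.log_natCast_nonneg _

lemma logDen_le {a b : ℕ} (ha : 1 ≤ a) (hab : a < b) (θ : ℝ) (n : ℕ) (ρ : ℝ) :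
    logDen a b θ n ρ ≤ n * Real.log (b + 1) := by
  have h1 := contQ_pos (one_le_mechWord ha hab θ ρ) n
  have h2 := contQ_le_pow (mechWord_le hab θ ρ) n
  rw [← Real.log_pow]
  exact Real.log_le_log (by exact_mod_cast h1) (by exact_mod_cast h2)

lemma abs_logDen_le {a b : ℕ} (ha : 1 ≤ a) (hab : a < b) (θ : ℝ) (n : ℕ) (ρ : ℝ) :
    |logDen a b θ n ρ| ≤ n * Real.log (b + 1) := by
  rw [abs_of_nonneg (logDen_nonneg a b θ n ρ)]
  exact logDen_le ha hab θ n ρ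

lemma logDen_add_int (a b : ℕ) (θ : ℝ) (n : ℕ) (ρ : ℝ) (z : ℤ) :
    logDen a b θ n (ρ + z) = logDen a b θ n ρ := by
  rw [logDen, mechWord_add_int, logDen]

/-- The logarithms of the continuants form an almost additive cocycle. -/
lemma abs_logDen_add_sub_le {a b : ℕ} (ha : 1 ≤ a) (hab : a < b) (θ : ℝ) (n m : ℕ) (ρ : ℝ) :
    |logDen a b θ (n + m) ρ - logDen a b θ n ρ - logDen a b θ m (ρ + n * θ)| ≤ Real.log 2 := by
  have hw := one_le_mechWord ha hab θ ρ
  obtain ⟨h1, h2⟩ := contQ_add_bounds hw n m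
  rw [mechWord_shift] at h1 h2
  have p1 : (0 : ℝ) < contQ (mechWord a b θ ρ) n := by exact_mod_cast contQ_pos hw n
  have p2 : (0 : ℝ) < contQ (mechWord a b θ (ρ + n * θ)) m := by
    exact_mod_cast contQ_pos (one_le_mechWord ha hab θ _) m
  have p3 : (0 : ℝ) < contQ (mechWord a b θ ρ) (n + m) := by exact_mod_cast contQ_pos hw _
  have h1' : (contQ (mechWord a b θ ρ) n : ℝ) * contQ (mechWord a b θ (ρ + n * θ)) m ≤
    contQ (mechWord a b θ ρ) (n + m) := by exact_mod_cast h1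
  have h2' : (contQ (mechWord a b θ ρ) (n + m) : ℝ) ≤
    2 * (contQ (mechWord a b θ ρ) n * contQ (mechWord a b θ (ρ + n * θ)) m) := by
    exact_mod_cast h2
  have l1 := Real.log_le_log (mul_pos p1 p2) h1'
  have l2 := Real.log_le_log p3 h2'
  rw [Real.log_mul p1.ne' p2.ne'] at l1
  rw [Real.log_mul two_ne_zero (mul_pos p1 p2).ne', Real.log_mul p1.ne' p2.ne'] at l2
  have := Real.log_nonneg one_le_two
  unfold logDen
  rw [abs_le]
  constructor <;> linarith

lemma measurable_contQ_mechWord (a b : ℕ) (θ : ℝ) (n : ℕ) :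
    Measurable fun ρ => contQ (mechWord a b θ ρ) n := by
  have hletter : ∀ j, Measurable fun ρ => mechWord a b θ ρ j := fun j => by
    unfold mechWord
    refine Measurable.ite ?_ measurable_const measurable_const
    exact measurableSet_eq_fun ((Int.measurable_floor.comp (measurable_const.add measurable_id)).sub
      (Int.measurable_floor.comp (measurable_const.add measurable_id))) measurable_const
  induction n using Nat.strong_induction_on with
  | _ n ih =>
    match n, ih with
    | 0, _ => exact measurable_const
    | 1, _ => exact hletter 1
    | n + 2, ih =>
      exact ((hletter (n + 2)).mul (ih (n + 1) (by omega))).add (ih n (by omega))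

lemma measurable_logDen (a b : ℕ) (θ : ℝ) (n : ℕ) : Measurable (logDen a b θ n) :=
  Real.measurable_log.comp (measurable_from_nat.comp (measurable_contQ_mechWord a b θ n))

lemma intervalIntegrable_logDen {a b : ℕ} (ha : 1 ≤ a) (hab : a < b) (θ : ℝ) (n : ℕ) (x y : ℝ) :
    IntervalIntegrable (logDen a b θ n) MeasureTheory.volume x y :=
  (intervalIntegrable_const (c := n * Real.log (b + 1))).mono_fun
    (measurable_logDen a b θ n).aestronglyMeasurable
    (Eventually.of_forall fun ρ => (abs_logDen_le ha hab θ n ρ).trans (le_abs_self _))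

lemma eventually_mechWord_eq (a b : ℕ) {θ ρ : ℝ}
    (h : ∀ (k z : ℤ), k * θ + ρ ≠ z) (n : ℕ) :
    ∀ᶠ θ' in nhds θ, mechWord a b θ' ρ n = mechWord a b θ ρ n := by
  have hfloor : ∀ k : ℤ, ∀ᶠ θ' in nhds θ, ⌊(k : ℝ) * θ' + ρ⌋ = ⌊(k : ℝ) * θ + ρ⌋ := fun k => by
    have hc : Tendsto (fun θ' : ℝ => (k : ℝ) * θ' + ρ) (nhds θ) (nhds (k * θ + ρ)) :=
      (by fun_prop : Continuous fun θ' : ℝ => (k : ℝ) * θ' + ρ).tendsto θ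
    have h1 : (⌊(k : ℝ) * θ + ρ⌋ : ℝ) < k * θ + ρ :=
      lt_of_le_of_ne (Int.floor_le _) (h k _).symm
    filter_upwards [hc.eventually_const_lt h1,
      hc.eventually_lt_const (Int.lt_floor_add_one ((k : ℝ) * θ + ρ))] with θ' h2 h3
    exact Int.floor_eq_iff.2 ⟨h2.le, h3⟩
  filter_upwards [hfloor n, hfloor (n - 1)] with θ' h1 h2
  push_cast at h1 h2
  unfold mechWord
  rw [h1, h2]

/-- The mean over the intercept of the logarithm of the `n`-th continuant. -/
noncomputable def meanLogDen (a b : ℕ) (n : ℕ) (θ : ℝ) : ℝ := ∫ ρ in (0 : ℝ)..1, logDen a b θ n ρ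

lemma continuous_meanLogDen {a b : ℕ} (ha : 1 ≤ a) (hab : a < b) (n : ℕ) :
    Continuous (meanLogDen a b n) := by
  rw [continuous_iff_continuousAt]
  intro θ
  refine intervalIntegral.continuousAt_of_dominated_interval
    (bound := fun _ => n * Real.log (b + 1))
    (Eventually.of_forall fun θ' => (measurable_logDen a b θ' n).aestronglyMeasurable)
    (Eventually.of_forall fun θ' => Eventually.of_forall fun ρ _ => abs_logDen_le ha hab θ' n ρ)
    intervalIntegrable_const ?_
  have hcount : (⋃ p : ℤ × ℤ, {(p.2 : ℝ) - p.1 * θ}).Countable :=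
    Set.countable_iUnion fun p => Set.countable_singleton _
  filter_upwards [hcount.ae_notMem MeasureTheory.volume] with ρ hρ _
  have hne : ∀ k z : ℤ, k * θ + ρ ≠ z := fun k z hkz =>
    hρ (Set.mem_iUnion.2 ⟨(k, z), by simp only [Set.mem_singleton_iff]; linarith⟩)
  have hall : ∀ᶠ θ' in nhds θ, ∀ j ∈ Finset.Icc 1 n, mechWord a b θ' ρ j = mechWord a b θ ρ j :=
    (Finset.eventually_all _).2 fun j _ => eventually_mechWord_eq a b hne j
  refine ContinuousAt.congr (f := fun _ => logDen a b θ n ρ) continuousAt_const ?_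
  filter_upwards [hall] with θ' h
  unfold logDen
  rw [contQ_congr fun j h1 h2 => (h j (Finset.mem_Icc.2 ⟨h1, h2⟩)).symm]

lemma abs_unitInterval_integral_le {f : ℝ → ℝ} {C : ℝ} (h : ∀ x, |f x| ≤ C) :
    |∫ x in (0 : ℝ)..1, f x| ≤ C := by
  simpa using intervalIntegral.norm_integral_le_of_norm_le_const (a := 0) (b := 1) (f := f)
    fun x _ => h x

lemma abs_meanLogDen_add_sub_le {a b : ℕ} (ha : 1 ≤ a) (hab : a < b) (n m : ℕ) (θ : ℝ) :
    |meanLogDen a b (n + m) θ - meanLogDen a b n θ - meanLogDen a b m θ| ≤ Real.log 2 := by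
  have hper : Function.Periodic (logDen a b θ m) 1 := fun ρ => by
    simpa using logDen_add_int a b θ m ρ 1
  have hshift : meanLogDen a b m θ = ∫ ρ in (0 : ℝ)..1, logDen a b θ m (ρ + n * θ) := by
    rw [intervalIntegral.integral_comp_add_right, zero_add, add_comm (1 : ℝ),
      hper.intervalIntegral_add_eq (n * θ) 0, zero_add, meanLogDen]
  have hint : IntervalIntegrable (fun ρ => logDen a b θ m (ρ + n * θ))
      MeasureTheory.volume 0 1 := by
    simpa using (intervalIntegrable_logDen ha hab θ m (0 + n * θ) (1 + n * θ)).comp_add_right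
      (n * θ)
  rw [hshift, meanLogDen, meanLogDen,
    ← intervalIntegral.integral_sub (intervalIntegrable_logDen ha hab θ _ _ _)
      (intervalIntegrable_logDen ha hab θ _ _ _),
    ← intervalIntegral.integral_sub ((intervalIntegrable_logDen ha hab θ _ _ _).sub
      (intervalIntegrable_logDen ha hab θ _ _ _)) hint]
  exact abs_unitInterval_integral_le fun ρ => abs_logDen_add_sub_le ha hab θ n m ρ

/-- An almost additive sequence has a mean, approached at rate `1 / n`. -/
lemma exists_forall_abs_sub_mul_le {u : ℕ → ℝ} {c : ℝ}
    (h : ∀ n m, |u (n + m) - u n - u m| ≤ c) : ∃ l : ℝ, ∀ n : ℕ, |u n - n * l| ≤ c := by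
  have hc : 0 ≤ c := (abs_nonneg _).trans (h 0 0)
  have hmul : ∀ n k : ℕ, |u ((k + 1) * n) - (k + 1) * u n| ≤ k * c := fun n k => by
    induction k with
    | zero => simp
    | succ k ih =>
      have := h ((k + 1) * n) n
      rw [← Nat.succ_mul] at this
      push_cast
      rw [abs_le] at *
      constructor <;> linarith [ih.1, ih.2, this.1, this.2]
  have hdist : ∀ n m : ℕ, |(m + 1) * u (n + 1) - (n + 1) * u (m + 1)| ≤ (n + m) * c := by
    intro n m
    have h1 := hmul (n + 1) m
    have h2 := hmul (m + 1) n
    rw [mul_comm] at h2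
    rw [abs_le] at *
    constructor <;> linarith [h1.1, h2.1, h1.2, h2.2]
  have hbound : ∀ n m : ℕ, |u (n + 1) / (n + 1) - u (m + 1) / (m + 1)| ≤
      c / (n + 1) + c / (m + 1) := fun n m => by
    have hn : (0 : ℝ) < n + 1 := by positivity
    have hm : (0 : ℝ) < m + 1 := by positivity
    rw [div_sub_div _ _ hn.ne' hm.ne', div_add_div _ _ hn.ne' hm.ne', abs_div,
      abs_of_pos (mul_pos hn hm)]
    gcongr
    rw [mul_comm (u (n + 1))]
    exact (hdist n m).trans (by linarith)
  have hlim : Tendsto (fun n : ℕ => c / ((n : ℝ) + 1)) atTop (nhds 0) := by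
    simpa [div_eq_mul_inv] using tendsto_one_div_add_atTop_nhds_zero_nat.const_mul c
  have hcauchy : CauchySeq fun n : ℕ => u (n + 1) / ((n : ℝ) + 1) := by
    refine cauchySeq_of_le_tendsto_0 (fun n : ℕ => 2 * (c / ((n : ℝ) + 1))) (fun n m N hn hm => ?_)
      (by simpa using hlim.const_mul 2)
    rw [Real.dist_eq]
    refine (hbound n m).trans ?_
    rw [two_mul]
    gcongr
  obtain ⟨l, hl⟩ := cauchySeq_tendsto_of_complete hcauchy
  refine ⟨l, fun n => ?_⟩
  match n with
  | 0 => simpa using h 0 0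
  | n + 1 =>
    have hn : (0 : ℝ) < n + 1 := by positivity
    have h1 : |u (n + 1) / (n + 1) - l| ≤ c / (n + 1) := by
      refine le_of_tendsto_of_tendsto (tendsto_const_nhds.sub hl).abs
        (by simpa using hlim.const_add (c / ((n : ℝ) + 1))) (Eventually.of_forall (hbound n))
    have h2 : u (n + 1) - ((n + 1 : ℕ) : ℝ) * l = (n + 1) * (u (n + 1) / (n + 1) - l) := by
      push_cast; field_simp
    rw [h2, abs_mul, abs_of_pos hn]
    calc (n + 1) * |u (n + 1) / (n + 1) - l| ≤ (n + 1) * (c / (n + 1)) := by gcongr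
      _ = c := by field_simp

lemma exists_continuous_mean {a b : ℕ} (ha : 1 ≤ a) (hab : a < b) :
    ∃ L : ℝ → ℝ, Continuous L ∧
      ∀ θ (n : ℕ), |meanLogDen a b n θ - n * L θ| ≤ Real.log 2 := by
  choose L hL using fun θ => exists_forall_abs_sub_mul_le
    (u := fun n => meanLogDen a b n θ) fun n m => abs_meanLogDen_add_sub_le ha hab n m θ
  refine ⟨L, ?_, hL⟩
  have hlim : Tendsto (fun n : ℕ => Real.log 2 * (1 / ((n : ℝ) + 1))) atTop (nhds 0) := by
    simpa using tendsto_one_div_add_atTop_nhds_zero_nat.const_mul (Real.log 2)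
  have hunif : TendstoUniformly (fun (n : ℕ) θ => meanLogDen a b (n + 1) θ / ((n : ℝ) + 1)) L
      atTop := by
    rw [Metric.tendstoUniformly_iff]
    intro ε hε
    filter_upwards [hlim.eventually_lt_const hε] with n hn θ
    have hp : (0 : ℝ) < n + 1 := by positivity
    refine lt_of_le_of_lt ?_ hn
    have h1 := hL θ (n + 1)
    push_cast at h1
    rw [dist_comm, Real.dist_eq, div_sub' hp.ne', abs_div, abs_of_pos hp, mul_one_div]
    gcongr
  exact hunif.continuous (Eventually.of_forall fun n =>
    (continuous_meanLogDen ha hab (n + 1)).div_const _).frequently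

lemma abs_logDen_shift_sub_le {a b : ℕ} (ha : 1 ≤ a) (hab : a < b) (θ : ℝ) (n k : ℕ) (ρ : ℝ) :
    |logDen a b θ n (ρ + k * θ) - logDen a b θ n ρ| ≤ 2 * Real.log 2 + k * Real.log (b + 1) := by
  have h1 := abs_logDen_add_sub_le ha hab θ k n ρ
  have h2 := abs_logDen_add_sub_le ha hab θ n k ρ
  have h3 := logDen_le ha hab θ k ρ
  have h4 := logDen_le ha hab θ k (ρ + n * θ)
  have h5 := logDen_nonneg a b θ k ρ
  have h6 := logDen_nonneg a b θ k (ρ + n * θ)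
  rw [add_comm k n] at h1
  rw [abs_le] at *
  constructor <;> linarith [h1.1, h1.2, h2.1, h2.2]

lemma mechWord_ratCast (a b : ℕ) (r : ℚ) (ρ : ℝ) :
    mechWord a b r ρ = mechWord a b r (⌊(r.den : ℝ) * ρ⌋ / r.den) := by
  have hq : (0 : ℝ) < r.den := by exact_mod_cast r.den_pos
  have hr : (r : ℝ) = r.num / r.den := Rat.cast_def r
  have hfloor : ∀ k : ℤ, ⌊(k : ℝ) * r + ρ⌋ = ⌊(k : ℝ) * r + ⌊(r.den : ℝ) * ρ⌋ / r.den⌋ := by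
    intro k
    refine eq_of_forall_le_iff fun z => ?_
    have h1 : (z : ℝ) ≤ k * r + ρ ↔ ((z * r.den - k * r.num : ℤ) : ℝ) ≤ r.den * ρ := by
      rw [hr, ← mul_le_mul_iff_left₀ hq]
      push_cast
      field_simp
      constructor <;> intro h <;> linarith
    have h2 : (z : ℝ) ≤ k * r + ⌊(r.den : ℝ) * ρ⌋ / r.den ↔
        ((z * r.den - k * r.num : ℤ) : ℝ) ≤ ⌊(r.den : ℝ) * ρ⌋ := by
      rw [hr, ← mul_le_mul_iff_left₀ hq]
      push_cast
      field_simp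
      constructor <;> intro h <;> linarith
    rw [Int.le_floor, Int.le_floor, h1, h2, Int.cast_le, Int.le_floor]
  funext n
  have h1 := hfloor n
  have h2 := hfloor (n - 1)
  push_cast at h1 h2
  unfold mechWord
  rw [h1, h2]

lemma exists_nat_mul_ratCast_add_int_eq (r : ℚ) (m : ℤ) :
    ∃ k ≤ r.den, ∃ z : ℤ, (k : ℝ) * r + z = m / r.den := by
  have hq : (r.den : ℝ) ≠ 0 := by exact_mod_cast r.den_ne_zero
  have hq' : (0 : ℤ) < r.den := by exact_mod_cast r.den_pos
  obtain ⟨u, v, huv⟩ := Rat.isCoprime_num_den r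
  have h0 := Int.emod_nonneg (m * u) hq'.ne'
  have h1 := Int.emod_lt_of_pos (m * u) hq'
  refine ⟨(m * u % r.den).toNat, by omega, m * u / r.den * r.num + m * v, ?_⟩
  have hk : (((m * u % r.den).toNat : ℕ) : ℝ) = ((m * u % r.den : ℤ) : ℝ) := by
    exact_mod_cast Int.toNat_of_nonneg h0
  have hz : (m * u % r.den) * r.num + (m * u / r.den * r.num + m * v) * r.den = m := by
    have := Int.emod_add_mul_ediv (m * u) r.den
    linear_combination r.num * this + m * huv
  have hz' : ((m * u % r.den : ℤ) : ℝ) * r.num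
      + ((m * u / r.den * r.num + m * v : ℤ) : ℝ) * r.den = m := by exact_mod_cast hz
  rw [hk, Rat.cast_def r]
  field_simp
  linarith

lemma exists_nat_mul_add_int_near {η : ℝ} (hη : 0 < η) (x : ℝ) :
    ∃ j ≤ ⌈1 / η⌉₊, ∃ z : ℤ, |(j : ℝ) * η + z - x| < η := by
  have hf := Int.fract_nonneg x
  have hf1 := Int.fract_lt_one x
  have h0 : 0 ≤ Int.fract x / η := by positivity
  refine ⟨⌊Int.fract x / η⌋₊, ?_, ⌊x⌋, ?_⟩
  · refine (Nat.floor_le_floor ?_).trans (Nat.floor_le_ceil _)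
    gcongr
  · have h1 := (le_div_iff₀ hη).1 (Nat.floor_le h0)
    have h2 := (div_lt_iff₀ hη).1 (Nat.lt_floor_add_one (Int.fract x / η))
    have h3 := Int.self_sub_floor x
    rw [abs_lt]
    constructor <;> linarith

/-- Orbits of an irrational rotation become dense at a uniform rate. -/
lemma exists_forall_nat_mul_add_int_near {θ : ℝ} (hθ : Irrational θ) {δ : ℝ} (hδ : 0 < δ) :
    ∃ K : ℕ, ∀ ρ : ℝ, ∃ k ≤ K, ∃ z : ℤ, |(k : ℝ) * θ + z - ρ| < δ := by
  obtain ⟨N, hN⟩ := exists_nat_one_div_lt hδ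
  obtain ⟨k₀, hk₀, -, hk⟩ := Real.exists_nat_abs_mul_sub_round_le θ N.succ_pos
  set z₀ := round ((k₀ : ℝ) * θ)
  have hne : (k₀ : ℝ) * θ - z₀ ≠ 0 :=
    sub_ne_zero.2 ((hθ.natCast_mul hk₀.ne').ne_int z₀)
  have hlt : |(k₀ : ℝ) * θ - z₀| < δ := by
    refine (hk.trans ?_).trans_lt hN
    gcongr
    linarith
  refine ⟨⌈1 / |(k₀ : ℝ) * θ - z₀|⌉₊ * k₀, fun ρ => ?_⟩
  rcases hne.lt_or_gt with h | h
  · obtain ⟨j, hj, z, hz⟩ := exists_nat_mul_add_int_near (abs_pos.2 hne) (-ρ)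
    refine ⟨j * k₀, Nat.mul_le_mul_right _ hj, -j * z₀ - z, lt_of_eq_of_lt ?_ (hz.trans hlt)⟩
    rw [abs_of_neg h, ← abs_neg]
    congr 1
    push_cast
    ring
  · obtain ⟨j, hj, z, hz⟩ := exists_nat_mul_add_int_near (abs_pos.2 hne) ρ
    refine ⟨j * k₀, Nat.mul_le_mul_right _ hj, -j * z₀ + z, lt_of_eq_of_lt ?_ (hz.trans hlt)⟩
    rw [abs_of_pos h]
    congr 1
    push_cast
    ring

lemma exists_pos_forall_le_abs_mul_sub {θ : ℝ} (hθ : Irrational θ) (M : ℕ) :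
    ∃ δ > 0, ∀ k : ℕ, 1 ≤ k → k ≤ M → ∀ z : ℤ, δ ≤ |(k : ℝ) * θ - z| := by
  induction M with
  | zero => exact ⟨1, one_pos, fun k h1 h2 => by omega⟩
  | succ M ih =>
    obtain ⟨δ, hδ, h⟩ := ih
    have hne : ((M + 1 : ℕ) : ℝ) * θ - round (((M + 1 : ℕ) : ℝ) * θ) ≠ 0 :=
      sub_ne_zero.2 ((hθ.natCast_mul M.succ_ne_zero).ne_int _)
    refine ⟨min δ _, lt_min hδ (abs_pos.2 hne), fun k h1 h2 z => ?_⟩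
    rcases Nat.le_succ_iff.1 h2 with h2 | rfl
    · exact (min_le_left _ _).trans (h k h1 h2 z)
    · exact (min_le_right _ _).trans (round_le _ z)

lemma card_floor_ne_le {θ δ : ℝ} {M : ℕ} (hM : 1 ≤ M)
    (hδ : ∀ k : ℕ, 1 ≤ k → k ≤ M → ∀ z : ℤ, δ ≤ |(k : ℝ) * θ - z|) {ρ₁ ρ₂ : ℝ}
    (h12 : ρ₁ ≤ ρ₂) (hlt : ρ₂ - ρ₁ < δ) (n : ℕ) :
    ((Finset.range (n + 1)).filter fun i : ℕ => ⌊(i : ℝ) * θ + ρ₁⌋ ≠ ⌊(i : ℝ) * θ + ρ₂⌋).card ≤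
      n / M + 1 := by
  have hcross : ∀ i : ℕ, ⌊(i : ℝ) * θ + ρ₁⌋ ≠ ⌊(i : ℝ) * θ + ρ₂⌋ →
      (i : ℝ) * θ + ρ₁ < ⌊(i : ℝ) * θ + ρ₂⌋ := fun i hi =>
    Int.floor_lt.1 (lt_of_le_of_ne (Int.floor_le_floor (by linarith)) hi)
  have hsep : ∀ i i' : ℕ, i < i' → i / M = i' / M →
      ⌊(i : ℝ) * θ + ρ₁⌋ ≠ ⌊(i : ℝ) * θ + ρ₂⌋ →
      ⌊(i' : ℝ) * θ + ρ₁⌋ = ⌊(i' : ℝ) * θ + ρ₂⌋ := by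
    intro i i' hii hdiv hi
    by_contra hi'
    have hle : i' - i ≤ M := by
      have h1 := Nat.div_add_mod i M
      have h2 := Nat.div_add_mod i' M
      have h3 := Nat.mod_lt i' (show 0 < M by omega)
      rw [hdiv] at h1
      omega
    have h1 := hcross i hi
    have h2 := hcross i' hi'
    have h3 := Int.floor_le ((i : ℝ) * θ + ρ₂)
    have h4 := Int.floor_le ((i' : ℝ) * θ + ρ₂)
    have h5 := hδ (i' - i) (by omega) hle (⌊(i' : ℝ) * θ + ρ₂⌋ - ⌊(i : ℝ) * θ + ρ₂⌋)
    refine absurd h5 (not_le.2 ?_)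
    rw [Nat.cast_sub hii.le, abs_lt]
    push_cast
    constructor <;> linarith
  calc _ ≤ (Finset.range (n / M + 1)).card := by
        refine Finset.card_le_card_of_injOn (· / M) (fun i hi => ?_) fun i hi i' hi' hdiv => ?_
        · have := (Finset.mem_filter.1 hi).1
          rw [Finset.mem_range] at this
          simp only [Finset.coe_range, Set.mem_Iio]
          exact Nat.lt_succ_of_le (Nat.div_le_div_right (by omega))
        · have h1 := (Finset.mem_filter.1 hi).2
          have h2 := (Finset.mem_filter.1 hi').2
          rcases lt_trichotomy i i' with h | h | h
          · exact absurd (hsep i i' h hdiv h1) h2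
          · exact h
          · exact absurd (hsep i' i h hdiv.symm h2) h1
    _ = n / M + 1 := Finset.card_range _

lemma card_mechWord_ne_le (a b : ℕ) {θ δ : ℝ} {M : ℕ} (hM : 1 ≤ M)
    (hδ : ∀ k : ℕ, 1 ≤ k → k ≤ M → ∀ z : ℤ, δ ≤ |(k : ℝ) * θ - z|) {ρ₁ ρ₂ : ℝ}
    (h12 : ρ₁ ≤ ρ₂) (hlt : ρ₂ - ρ₁ < δ) (n : ℕ) :
    ((Finset.Icc 1 n).filter fun j => mechWord a b θ ρ₁ j ≠ mechWord a b θ ρ₂ j).card ≤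
      2 * (n / M + 1) := by
  set D := (Finset.range (n + 1)).filter
    fun i : ℕ => ⌊(i : ℝ) * θ + ρ₁⌋ ≠ ⌊(i : ℝ) * θ + ρ₂⌋
  have hsub : ((Finset.Icc 1 n).filter fun j => mechWord a b θ ρ₁ j ≠ mechWord a b θ ρ₂ j) ⊆
      D ∪ D.image (· + 1) := by
    intro j hj
    obtain ⟨hj1, hj2⟩ := Finset.mem_filter.1 hj
    rw [Finset.mem_Icc] at hj1
    by_contra hnot
    rw [Finset.mem_union, not_or, Finset.mem_image] at hnot
    obtain ⟨i, rfl⟩ : ∃ i, j = i + 1 := ⟨j - 1, by omega⟩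
    have e1 : ⌊((i + 1 : ℕ) : ℝ) * θ + ρ₁⌋ = ⌊((i + 1 : ℕ) : ℝ) * θ + ρ₂⌋ := by
      by_contra h
      exact hnot.1 (Finset.mem_filter.2 ⟨Finset.mem_range.2 (by omega), h⟩)
    have e2 : ⌊(i : ℝ) * θ + ρ₁⌋ = ⌊(i : ℝ) * θ + ρ₂⌋ := by
      by_contra h
      exact hnot.2 ⟨i, Finset.mem_filter.2 ⟨Finset.mem_range.2 (by omega), h⟩, rfl⟩
    apply hj2
    unfold mechWord
    rw [e1, show ((i + 1 : ℕ) : ℝ) - 1 = i by push_cast; ring, e2]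
  have hcard : D.card ≤ n / M + 1 := card_floor_ne_le hM hδ h12 hlt n
  calc _ ≤ (D ∪ D.image (· + 1)).card := Finset.card_le_card hsub
    _ ≤ D.card + (D.image (· + 1)).card := Finset.card_union_le _ _
    _ ≤ D.card + D.card := Nat.add_le_add_left Finset.card_image_le _
    _ ≤ 2 * (n / M + 1) := by omega

lemma logDen_sub_le_card_mul {a b : ℕ} (ha : 1 ≤ a) (hab : a < b) (θ ρ₁ ρ₂ : ℝ) (n : ℕ) :
    logDen a b θ n ρ₁ - logDen a b θ n ρ₂ ≤
      ((Finset.Icc 1 n).filter fun j => mechWord a b θ ρ₁ j ≠ mechWord a b θ ρ₂ j).card *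
        Real.log b := by
  have h := contQ_le_pow_card_mul (mechWord_le hab θ ρ₁) (one_le_mechWord ha hab θ ρ₂)
    (by omega) n
  set c := ((Finset.Icc 1 n).filter fun j => mechWord a b θ ρ₁ j ≠ mechWord a b θ ρ₂ j).card
  have h' : (contQ (mechWord a b θ ρ₁) n : ℝ) ≤ (b : ℝ) ^ c * contQ (mechWord a b θ ρ₂) n := by
    exact_mod_cast h
  have p1 : (0 : ℝ) < contQ (mechWord a b θ ρ₁) n := by
    exact_mod_cast contQ_pos (one_le_mechWord ha hab θ ρ₁) n
  have p2 : (0 : ℝ) < contQ (mechWord a b θ ρ₂) n := by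
    exact_mod_cast contQ_pos (one_le_mechWord ha hab θ ρ₂) n
  have hb : (0 : ℝ) < b := by exact_mod_cast (by omega : 0 < b)
  have := Real.log_le_log p1 h'
  rw [Real.log_mul (pow_pos hb c).ne' p2.ne', Real.log_pow] at this
  unfold logDen
  linarith

lemma abs_logDen_sub_le_of_close {a b : ℕ} (ha : 1 ≤ a) (hab : a < b) {θ δ : ℝ} {M : ℕ}
    (hM : 1 ≤ M) (hδ : ∀ k : ℕ, 1 ≤ k → k ≤ M → ∀ z : ℤ, δ ≤ |(k : ℝ) * θ - z|) {ρ₁ ρ₂ : ℝ}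
    (hlt : |ρ₁ - ρ₂| < δ) (n : ℕ) :
    |logDen a b θ n ρ₁ - logDen a b θ n ρ₂| ≤ 2 * (n / M + 1) * Real.log b := by
  wlog h12 : ρ₁ ≤ ρ₂ generalizing ρ₁ ρ₂
  · rw [abs_sub_comm]
    exact this (by rwa [abs_sub_comm]) (le_of_not_ge h12)
  rw [abs_sub_comm, abs_of_nonneg (sub_nonneg.2 h12)] at hlt
  have hcard := card_mechWord_ne_le a b hM hδ h12 hlt n
  have h1 := logDen_sub_le_card_mul ha hab θ ρ₁ ρ₂ n
  have h2 := logDen_sub_le_card_mul ha hab θ ρ₂ ρ₁ n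
  simp only [ne_comm (a := mechWord a b θ ρ₂ _)] at h2
  have hlog : 0 ≤ Real.log b := Real.log_natCast_nonneg b
  have hcard' : ((((Finset.Icc 1 n).filter
      fun j => mechWord a b θ ρ₁ j ≠ mechWord a b θ ρ₂ j).card : ℕ) : ℝ) ≤
      2 * (n / M + 1) := by
    refine (Nat.cast_le.2 hcard).trans ?_
    push_cast
    gcongr
    exact Nat.cast_div_le
  have h3 := mul_le_mul_of_nonneg_right hcard' hlog
  rw [abs_le]
  constructor <;> linarith

/-- Up to `o(n)`, the logarithm of the `n`-th continuant does not depend on the intercept. -/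
lemma exists_forall_abs_logDen_sub_le {a b : ℕ} (ha : 1 ≤ a) (hab : a < b) (θ : ℝ) {ε : ℝ}
    (hε : 0 < ε) :
    ∃ C : ℝ, ∀ (n : ℕ) (ρ : ℝ), |logDen a b θ n ρ - logDen a b θ n 0| ≤ ε * n + C := by
  have hlogb : 0 ≤ Real.log b := Real.log_natCast_nonneg b
  have hlogb1 : 0 ≤ Real.log ((b : ℝ) + 1) := Real.log_nonneg (by linarith [b.cast_nonneg (α := ℝ)])
  by_cases hθ : Irrational θ
  · set M := ⌈2 * Real.log b / ε⌉₊ + 1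
    have hM : 2 * Real.log b / M ≤ ε := by
      rw [div_le_comm₀ (by positivity) hε]
      exact (Nat.le_ceil _).trans (by simp [M])
    obtain ⟨δ, hδ0, hδ⟩ := exists_pos_forall_le_abs_mul_sub hθ M
    obtain ⟨K, hK⟩ := exists_forall_nat_mul_add_int_near hθ hδ0
    refine ⟨2 * Real.log b + (2 * Real.log 2 + K * Real.log (b + 1)), fun n ρ => ?_⟩
    obtain ⟨k, hk, z, hz⟩ := hK ρ
    have h1 := abs_logDen_sub_le_of_close ha hab (by simp [M]) hδ hz n
    have h2 := abs_logDen_shift_sub_le ha hab θ n k 0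
    have h3 : (k : ℝ) * Real.log (b + 1) ≤ K * Real.log (b + 1) := by gcongr
    have h4 : 2 * ((n : ℝ) / M + 1) * Real.log b ≤ ε * n + 2 * Real.log b :=
      calc 2 * ((n : ℝ) / M + 1) * Real.log b = 2 * Real.log b / M * n + 2 * Real.log b := by ring
        _ ≤ _ := by gcongr
    rw [logDen_add_int] at h1
    rw [zero_add] at h2
    rw [abs_le] at *
    constructor <;> linarith [h1.1, h1.2, h2.1, h2.2]
  · obtain ⟨r, rfl⟩ : ∃ r : ℚ, (r : ℝ) = θ := by simpa [Irrational] using hθ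
    refine ⟨2 * Real.log 2 + r.den * Real.log (b + 1), fun n ρ => ?_⟩
    obtain ⟨k, hk, z, hz⟩ := exists_nat_mul_ratCast_add_int_eq r ⌊(r.den : ℝ) * ρ⌋
    have h1 := abs_logDen_shift_sub_le ha hab r n k 0
    rw [zero_add, ← logDen_add_int a b r n _ z, hz, logDen, ← mechWord_ratCast] at h1
    have h3 : (k : ℝ) * Real.log (b + 1) ≤ r.den * Real.log (b + 1) := by gcongr
    have h4 : 0 ≤ ε * n := by positivity
    exact h1.trans (by linarith)

lemma hasLevyConstant_mechWord {a b : ℕ} (ha : 1 ≤ a) (hab : a < b) {θ l : ℝ}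
    (hl : ∀ n : ℕ, |meanLogDen a b n θ - n * l| ≤ Real.log 2) :
    HasLevyConstant (mechWord a b θ 0) l := by
  rw [HasLevyConstant, Metric.tendsto_atTop']
  intro ε hε
  obtain ⟨C, hC⟩ := exists_forall_abs_logDen_sub_le ha hab θ (half_pos hε)
  have hmean : ∀ n : ℕ, |meanLogDen a b n θ - logDen a b θ n 0| ≤ ε / 2 * n + C := fun n => by
    have h0 : meanLogDen a b n θ - logDen a b θ n 0 =
        ∫ ρ in (0 : ℝ)..1, (logDen a b θ n ρ - logDen a b θ n 0) := by
      rw [intervalIntegral.integral_sub (intervalIntegrable_logDen ha hab θ _ _ _)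
        intervalIntegrable_const]
      simp [meanLogDen]
    rw [h0]
    exact abs_unitInterval_integral_le (hC n)
  obtain ⟨N, hN⟩ := exists_nat_gt ((C + Real.log 2) / (ε / 2))
  refine ⟨N, fun n hn => ?_⟩
  have hn0 : (0 : ℝ) < n := by exact_mod_cast (by omega : 0 < n)
  have h1 : C + Real.log 2 < n * (ε / 2) := by
    rw [← div_lt_iff₀ (half_pos hε)]
    exact hN.trans (by exact_mod_cast hn)
  have h2 := hmean n
  have h3 := hl n
  rw [Real.dist_eq, div_sub' hn0.ne', abs_div, abs_of_pos hn0, div_lt_iff₀ hn0]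
  change |logDen a b θ n 0 - n * l| < _
  rw [abs_le] at h2 h3
  rw [abs_lt]
  constructor <;> linarith [h2.1, h2.2, h3.1, h3.2]

lemma HasLevyConstant.mono {w w' : ℕ → ℕ} {l l' : ℝ} (hw : ∀ n, 1 ≤ w n)
    (hle : ∀ n, w n ≤ w' n) (h : HasLevyConstant w l) (h' : HasLevyConstant w' l') : l ≤ l' := by
  refine le_of_tendsto_of_tendsto' h h' fun n => ?_
  have h1 := contQ_pos hw n
  have h2 := contQ_mono hle n
  gcongr

/-- For `1 ≤ a < b`, the set of Lévy constants of the continued fractions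
`[0; s_{θ,0}]`, where `s_{θ,0}` is the mechanical word over `{a,b}` of slope `θ ∈ [0,1]`
and intercept `0`, is the whole interval `[𝓛([0; a,a,…]), 𝓛([0; b,b,…])]`. -/
theorem stmt1 (a b : ℕ) (ha : 1 ≤ a) (hab : a < b) (ℓa ℓb : ℝ)
    (hℓa : HasLevyConstant (fun _ => a) ℓa) (hℓb : HasLevyConstant (fun _ => b) ℓb) :
    {ℓ : ℝ | ∃ θ ∈ Set.Icc (0 : ℝ) 1, HasLevyConstant (mechWord a b θ 0) ℓ}
      = Set.Icc ℓa ℓb := by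
  obtain ⟨L, hLc, hL⟩ := exists_continuous_mean ha hab
  have hlevy : ∀ θ, HasLevyConstant (mechWord a b θ 0) (L θ) := fun θ =>
    hasLevyConstant_mechWord ha hab (hL θ)
  ext ℓ
  constructor
  · rintro ⟨θ, -, h⟩
    exact ⟨hℓa.mono (fun _ => ha) (le_mechWord hab θ 0) h,
      h.mono (one_le_mechWord ha hab θ 0) (mechWord_le hab θ 0) hℓb⟩
  · intro hℓ
    have h0 : L 0 = ℓa := tendsto_nhds_unique (mechWord_zero_zero a b ▸ hlevy 0) hℓa
    have h1 : L 1 = ℓb := tendsto_nhds_unique (mechWord_one_zero a b ▸ hlevy 1) hℓb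
    rw [← h0, ← h1] at hℓ
    obtain ⟨θ, hθ, rfl⟩ := intermediate_value_Icc zero_le_one hLc.continuousOn hℓ
    exact ⟨θ, hθ, hlevy θ⟩
end

section
/- Let s be a Sturmian word over {a,b} with slope θ = [0; 1+d_1, d_2, ...], d_1 ≥ 1, and let M be a factor of s of length n with q_k ≤ n ≤ q_{k+1} − 1. Then either (a) M is a factor of a word of the form M_k M_k ... M_k M_{k−1} (finitely many copies of M_k followed by M_{k−1}), or (b) M = UV, where U is a suffix of M_{k+1} and V is a prefix of M_{k+1} with |V| ≥ q_k − 1. -/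
open Filter Real Matrix

/-- The concatenation of the first `n` blocks read by the exchange of two intervals on `[-u, v)`:
a negative point reads `A` and moves by `v`, a nonnegative point reads `B` and moves by `-u`. -/
noncomputable def exchangeWord (A B : List ℕ) (u v : ℝ) : ℕ → ℝ → List ℕ
  | 0, _ => []
  | n + 1, x =>
    if x < 0 then A ++ exchangeWord A B u v n (x + v) else B ++ exchangeWord A B u v n (x - u)

lemma exchangeWord_succ_of_neg (A B : List ℕ) (u v : ℝ) (n : ℕ) {x : ℝ} (hx : x < 0) :
    exchangeWord A B u v (n + 1) x = A ++ exchangeWord A B u v n (x + v) := by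
  rw [exchangeWord, if_pos hx]

lemma exchangeWord_succ_of_nonneg (A B : List ℕ) (u v : ℝ) (n : ℕ) {x : ℝ} (hx : 0 ≤ x) :
    exchangeWord A B u v (n + 1) x = B ++ exchangeWord A B u v n (x - u) := by
  rw [exchangeWord, if_neg (not_lt.2 hx)]

/-- The point `x` is not in the group generated by `u` and `v`. -/
def IsGeneric (u v x : ℝ) : Prop := ∀ m l : ℤ, x ≠ m * u + l * v

lemma exchangeWord_swap (A B : List ℕ) (u v : ℝ) (n : ℕ) (x : ℝ) (hx : IsGeneric u v x) :
    exchangeWord A B u v n x = exchangeWord B A v u n (-x) := by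
  induction n generalizing x with
  | zero => rfl
  | succ n ih =>
    have h0 : x ≠ 0 := by simpa using hx 0 0
    rcases lt_or_gt_of_ne h0 with h | h
    · rw [exchangeWord_succ_of_neg _ _ _ _ _ h,
        exchangeWord_succ_of_nonneg _ _ _ _ _ (by linarith), ih]
      · congr 2; ring
      · intro m l e
        apply hx m (l - 1)
        push_cast; linarith
    · rw [exchangeWord_succ_of_nonneg _ _ _ _ _ h.le,
        exchangeWord_succ_of_neg _ _ _ _ _ (by linarith), ih]
      · congr 2; ring
      · intro m l e
        apply hx (m + 1) l
        push_cast; linarith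

lemma exchangeWord_prefix_induced (A B : List ℕ) (u v : ℝ) (huv : v < u) (n : ℕ)
    (x : ℝ) (hx0 : x < 0) :
    ∃ n', exchangeWord A B u v n x <+: exchangeWord A (A ++ B) (u - v) v n' (x + v) := by
  induction n using Nat.strong_induction_on generalizing x with
  | _ n ih =>
    match n with
    | 0 => exact ⟨0, List.nil_prefix⟩
    | n + 1 =>
      rw [exchangeWord_succ_of_neg _ _ _ _ _ hx0]
      rcases lt_or_ge (x + v) 0 with h | h
      · obtain ⟨n', hn'⟩ := ih n (by omega) (x + v) h
        refine ⟨n' + 1, ?_⟩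
        rw [exchangeWord_succ_of_neg _ _ _ _ _ h]
        exact (List.prefix_append_right_inj A).2 hn'
      · match n with
        | 0 =>
          refine ⟨1, ?_⟩
          rw [exchangeWord_succ_of_nonneg _ _ _ _ _ h]
          simp [exchangeWord]
        | n + 1 =>
          obtain ⟨n', hn'⟩ := ih n (by omega) (x + v - u) (by linarith)
          refine ⟨n' + 1, ?_⟩
          rw [exchangeWord_succ_of_nonneg _ _ _ _ _ h, exchangeWord_succ_of_nonneg _ _ _ _ _ h,
            List.append_assoc, List.prefix_append_right_inj, List.prefix_append_right_inj]
          convert hn' using 2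
          ring

lemma exchangeWord_infix_induced (A B : List ℕ) (u v : ℝ) (huv : v < u) (n : ℕ)
    (x : ℝ) (hx : x ∈ Set.Ico (-u) v) (hg : IsGeneric u v x) :
    ∃ n' y, y ∈ Set.Ico (-(u - v)) v ∧ IsGeneric (u - v) v y ∧
      exchangeWord A B u v n x <:+: exchangeWord A (A ++ B) (u - v) v n' y := by
  rcases lt_or_ge x 0 with h | h
  · obtain ⟨n', hn'⟩ := exchangeWord_prefix_induced A B u v huv n x h
    refine ⟨n', x + v, ⟨by linarith [hx.1], by linarith⟩, ?_, hn'.isInfix⟩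
    intro m l e
    apply hg m (l - m - 1)
    push_cast; linarith
  · obtain ⟨n', hn'⟩ := exchangeWord_prefix_induced A B u v huv (n + 1) (x - v)
      (by linarith [hx.2])
    rw [exchangeWord_succ_of_neg _ _ _ _ _ (by linarith [hx.2]), sub_add_cancel] at hn'
    refine ⟨n', x, ⟨by linarith, hx.2⟩, ?_, (List.suffix_append A _).isInfix.trans hn'.isInfix⟩
    intro m l e
    apply hg m (l - m)
    push_cast; linarith

lemma exchangeWord_infix_iterate (A B : List ℕ) (u v : ℝ) (hv : 0 < v) (d : ℕ)
    (hd : 0 < u - d * v) (n : ℕ) (x : ℝ) (hx : x ∈ Set.Ico (-u) v) (hg : IsGeneric u v x) :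
    ∃ n' y, y ∈ Set.Ico (-(u - d * v)) v ∧ IsGeneric (u - d * v) v y ∧
      exchangeWord A B u v n x <:+:
        exchangeWord A ((List.replicate d A).flatten ++ B) (u - d * v) v n' y := by
  induction d with
  | zero => exact ⟨n, x, by simpa using hx, by simpa using hg, by simp⟩
  | succ d ih =>
    push_cast at hd
    obtain ⟨n₁, y₁, hy₁, hg₁, h₁⟩ := ih (by linarith)
    obtain ⟨n₂, y₂, hy₂, hg₂, h₂⟩ := exchangeWord_infix_induced A
      ((List.replicate d A).flatten ++ B) (u - d * v) v (by linarith) n₁ y₁ hy₁ hg₁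
    have e : u - (d : ℝ) * v - v = u - ((d + 1 : ℕ) : ℝ) * v := by push_cast; ring
    rw [e] at hy₂ hg₂ h₂
    refine ⟨n₂, y₂, hy₂, hg₂, h₁.trans ?_⟩
    simpa [List.replicate_succ] using h₂

lemma exchangeWord_infix_renormalize (A B : List ℕ) (u v : ℝ) (hv : 0 < v) (d : ℕ)
    (hd : 0 < u - d * v) (n : ℕ) (x : ℝ) (hx : x ∈ Set.Ico (-u) v) (hg : IsGeneric u v x) :
    ∃ n' y, y ∈ Set.Ico (-v) (u - d * v) ∧ IsGeneric v (u - d * v) y ∧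
      exchangeWord A B u v n x <:+:
        exchangeWord ((List.replicate d A).flatten ++ B) A v (u - d * v) n' y := by
  obtain ⟨n', y, hy, hg', h⟩ := exchangeWord_infix_iterate A B u v hv d hd n x hx hg
  rw [exchangeWord_swap _ _ _ _ _ _ hg'] at h
  refine ⟨n', -y, ⟨by linarith [hy.2], ?_⟩, ?_, h⟩
  · refine lt_of_le_of_ne (by linarith [hy.1]) fun e => hg' (-1) 0 ?_
    push_cast; linarith
  · intro m l e
    apply hg' (-l) (-m)
    push_cast; linarith

/-- The distance `|q_k θ - p_k|`, as `(-1)^k (q_k θ - p_k)`. -/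
noncomputable def cfGap (d : ℕ → ℕ) (θ : ℝ) (k : ℕ) : ℝ :=
  (-1) ^ k * (cfQ d k * θ - cfP d k)

lemma cfGap_add_two (d : ℕ → ℕ) (θ : ℝ) (k : ℕ) :
    cfGap d θ (k + 2) = cfGap d θ k - d (k + 2) * cfGap d θ (k + 1) := by
  simp only [cfGap, cfQ, cfP]
  push_cast
  ring

lemma cfQ_pos (d : ℕ → ℕ) (k : ℕ) : 0 < cfQ d k := by
  induction k using Nat.strong_induction_on with
  | _ k ih =>
    match k with
    | 0 => simp [cfQ]
    | 1 => simp [cfQ]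
    | k + 2 =>
      have := ih k (by omega)
      simp only [cfQ]
      omega

lemma cfP_mul_cfQ_sub (d : ℕ → ℕ) (k : ℕ) :
    (cfP d (k + 1) : ℝ) * cfQ d k - cfP d k * cfQ d (k + 1) = (-1) ^ k := by
  induction k with
  | zero => simp [cfP, cfQ]
  | succ k ih =>
    rw [pow_succ, ← ih]
    simp only [cfP, cfQ]
    push_cast
    ring

lemma cfP_div_cfQ_add_two (d : ℕ → ℕ) (k : ℕ) :
    (-1) ^ k * ((cfP d k : ℝ) / cfQ d k) ≤ (-1) ^ k * ((cfP d (k + 2) : ℝ) / cfQ d (k + 2)) := by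
  have hq : (0 : ℝ) < cfQ d k := by exact_mod_cast cfQ_pos d k
  have hq' : (0 : ℝ) < cfQ d (k + 2) := by exact_mod_cast cfQ_pos d (k + 2)
  have key : (cfP d (k + 2) : ℝ) * cfQ d k - cfP d k * cfQ d (k + 2) = d (k + 2) * (-1) ^ k := by
    rw [← cfP_mul_cfQ_sub d k]
    simp only [cfP, cfQ]
    push_cast
    ring
  have hs : ((-1 : ℝ) ^ k) * (-1) ^ k = 1 := by rw [← mul_pow]; simp
  rw [← sub_nonneg, ← mul_sub, div_sub_div _ _ hq'.ne' hq.ne', ← mul_div_assoc]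
  apply div_nonneg _ (by positivity)
  have : (-1 : ℝ) ^ k * ((cfP d (k + 2) : ℝ) * cfQ d k - cfQ d (k + 2) * cfP d k)
      = d (k + 2) := by
    rw [mul_comm (cfQ d (k + 2) : ℝ), key, mul_left_comm, hs, mul_one]
  rw [this]
  positivity

lemma cfGap_pos (d : ℕ → ℕ) (θ : ℝ) (hθ : Irrational θ)
    (hθd : Tendsto (fun k => (cfP d k : ℝ) / (cfQ d k : ℝ)) atTop (nhds θ)) (k : ℕ) :
    0 < cfGap d θ k := by
  have hq : (0 : ℝ) < cfQ d k := by exact_mod_cast cfQ_pos d k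
  have hmono : Monotone fun j : ℕ =>
      (-1 : ℝ) ^ k * ((cfP d (k + 2 * j) : ℝ) / cfQ d (k + 2 * j)) := by
    refine monotone_nat_of_le_succ fun j => ?_
    have h := cfP_div_cfQ_add_two d (k + 2 * j)
    have e : (-1 : ℝ) ^ (k + 2 * j) = (-1) ^ k := by rw [pow_add, pow_mul]; simp
    rw [e] at h
    exact h
  have hlim : Tendsto (fun j : ℕ =>
      (-1 : ℝ) ^ k * ((cfP d (k + 2 * j) : ℝ) / cfQ d (k + 2 * j))) atTop
      (nhds ((-1) ^ k * θ)) := by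
    refine Tendsto.const_mul _ (hθd.comp (tendsto_atTop_mono (f := id) (fun j => ?_) tendsto_id))
    simp only [id]
    omega
  have hle := hmono.ge_of_tendsto hlim 0
  simp only [mul_zero, add_zero] at hle
  have hne : (cfQ d k : ℝ) * θ - cfP d k ≠ 0 := by
    intro e
    apply (irrational_iff_ne_rational θ).1 hθ (cfP d k) (cfQ d k)
      (by exact_mod_cast (cfQ_pos d k).ne')
    rw [eq_div_iff (by exact_mod_cast hq.ne')]
    push_cast
    linarith
  refine lt_of_le_of_ne ?_ (Ne.symm (mul_ne_zero (by simp) hne))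
  have h : cfGap d θ k = ((-1) ^ k * θ - (-1) ^ k * ((cfP d k : ℝ) / cfQ d k)) * cfQ d k := by
    rw [cfGap]
    field_simp
  rw [h]
  exact mul_nonneg (by linarith) hq.le

lemma exchangeWord_infix_sturmM (a b : ℕ) (d : ℕ → ℕ) (θ : ℝ) (hgap : ∀ k, 0 < cfGap d θ k)
    (k n : ℕ) (x : ℝ) (hx : x ∈ Set.Ico (-(1 - θ)) θ) (hg : IsGeneric (1 - θ) θ x) :
    ∃ n' y, exchangeWord [a] [b] (1 - θ) θ n x <:+:
      exchangeWord (sturmM a b d (k + 2)) (sturmM a b d (k + 1)) (cfGap d θ k)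
        (cfGap d θ (k + 1)) n' y ∧
      y ∈ Set.Ico (-cfGap d θ k) (cfGap d θ (k + 1)) ∧
      IsGeneric (cfGap d θ k) (cfGap d θ (k + 1)) y := by
  induction k with
  | zero =>
    have h0 : cfGap d θ 0 = θ := by simp [cfGap, cfQ, cfP]
    have h1 : cfGap d θ (0 + 1) = 1 - θ - d 1 * θ := by
      simp only [cfGap, cfQ, cfP]
      push_cast
      ring
    have hp := hgap (0 + 1)
    have hp0 := hgap 0
    rw [h1] at hp ⊢
    rw [h0] at hp0 ⊢
    obtain ⟨n', y, hy, hg', h⟩ :=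
      exchangeWord_infix_renormalize [a] [b] (1 - θ) θ hp0 (d 1) hp n x hx hg
    exact ⟨n', y, h, hy, hg'⟩
  | succ k ih =>
    obtain ⟨n₁, y₁, h₁, hy₁, hg₁⟩ := ih
    have hp := hgap (k + 2)
    rw [cfGap_add_two] at hp
    obtain ⟨n', y, hy, hg', h⟩ := exchangeWord_infix_renormalize _ _ _ _ (hgap (k + 1))
      (d (k + 2)) hp n₁ y₁ hy₁ hg₁
    rw [← cfGap_add_two] at hy hg' h
    exact ⟨n', y, h₁.trans h, hy, hg'⟩

lemma map_floor_eq_exchangeWord (a b : ℕ) (θ : ℝ) (h0 : 0 < θ) (h1 : θ < 1) (n : ℕ) (r : ℝ) :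
    ((List.range n).map fun j : ℕ =>
      if ⌊r + ((j : ℝ) + 1) * θ⌋ - ⌊r + (j : ℝ) * θ⌋ = 0 then a else b) =
      exchangeWord [a] [b] (1 - θ) θ n (Int.fract r - (1 - θ)) := by
  induction n generalizing r with
  | zero => rfl
  | succ n ih =>
    have ih' := ih (r + θ)
    have hl := Int.fract_nonneg r
    have hu := Int.fract_lt_one r
    have hr := Int.self_sub_floor r
    rw [List.range_succ_eq_map, List.map_cons, List.map_map]
    have hcongr : ((fun j : ℕ =>
        if ⌊r + ((j : ℝ) + 1) * θ⌋ - ⌊r + (j : ℝ) * θ⌋ = 0 then a else b) ∘ Nat.succ) =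
        fun j : ℕ =>
        if ⌊r + θ + ((j : ℝ) + 1) * θ⌋ - ⌊r + θ + (j : ℝ) * θ⌋ = 0 then a else b := by
      funext j
      simp only [Function.comp, Nat.succ_eq_add_one]
      push_cast
      have e1 : r + ((j : ℝ) + 1 + 1) * θ = r + θ + ((j : ℝ) + 1) * θ := by ring
      have e2 : r + ((j : ℝ) + 1) * θ = r + θ + (j : ℝ) * θ := by ring
      rw [e1, e2]
    rw [hcongr, ih']
    simp only [Nat.cast_zero, zero_add, one_mul, zero_mul, add_zero]
    rcases lt_or_ge (Int.fract r) (1 - θ) with h | h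
    · have hf : ⌊r + θ⌋ = ⌊r⌋ := by
        rw [Int.floor_eq_iff]
        constructor <;> linarith
      rw [exchangeWord_succ_of_neg _ _ _ _ _ (by linarith), hf]
      have : Int.fract (r + θ) = Int.fract r + θ := by
        rw [← Int.self_sub_floor, hf]; linarith
      rw [this]
      simp only [sub_self, if_true, List.singleton_append]
      congr 2
      ring
    · have hf : ⌊r + θ⌋ = ⌊r⌋ + 1 := by
        rw [Int.floor_eq_iff]
        push_cast
        constructor <;> linarith
      rw [exchangeWord_succ_of_nonneg _ _ _ _ _ (by linarith), hf]
      have : Int.fract (r + θ) = Int.fract r + θ - 1 := by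
        rw [← Int.self_sub_floor, hf]; push_cast; linarith
      rw [this]
      simp only [add_sub_cancel_left, one_ne_zero, if_false, List.singleton_append]
      congr 2
      ring

lemma eventually_floor_add_eq (x : ℝ) : ∀ᶠ ε in nhdsWithin (0 : ℝ) (Set.Ioi 0),
    ⌊x + ε⌋ = ⌊x⌋ := by
  have h : (0 : ℝ) < ⌊x⌋ + 1 - x := by linarith [Int.lt_floor_add_one x]
  filter_upwards [Ioo_mem_nhdsGT h] with ε hε
  rw [Int.floor_eq_iff]
  constructor <;> linarith [hε.1, hε.2, Int.floor_le x]

lemma eventually_floor_sub_eq (x : ℝ) : ∀ᶠ ε in nhdsWithin (0 : ℝ) (Set.Ioi 0),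
    ⌊x - ε⌋ = ⌈x⌉ - 1 := by
  have h : (0 : ℝ) < x - (⌈x⌉ - 1) := by linarith [Int.ceil_lt_add_one x]
  filter_upwards [Ioo_mem_nhdsGT h] with ε hε
  rw [Int.floor_eq_iff]
  push_cast
  constructor <;> linarith [hε.1, hε.2, Int.le_ceil x]

lemma countable_int_combinations (θ c : ℝ) :
    {x : ℝ | ∃ m l : ℤ, c + x = m + l * θ ∨ c - x = m + l * θ}.Countable := by
  have h : {x : ℝ | ∃ m l : ℤ, c + x = m + l * θ ∨ c - x = m + l * θ} ⊆
      Set.range (fun p : ℤ × ℤ => (p.1 : ℝ) + p.2 * θ - c) ∪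
      Set.range (fun p : ℤ × ℤ => c - ((p.1 : ℝ) + p.2 * θ)) := by
    rintro x ⟨m, l, h | h⟩
    · exact Or.inl ⟨(m, l), by simp only; linarith⟩
    · exact Or.inr ⟨(m, l), by simp only; linarith⟩
  exact ((Set.countable_range _).union (Set.countable_range _)).mono h

/-- A finite factor of a mechanical word is read along a generic orbit of the exchange of two
intervals. -/
lemma factor_eq_exchangeWord (a b : ℕ) (θ ρ : ℝ) (h0 : 0 < θ) (h1 : θ < 1) (s : ℕ → ℕ)
    (hs : s = mechWord a b θ ρ ∨ s = mechWord' a b θ ρ) (M : List ℕ) (hM : IsFactorSeq s M) :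
    ∃ x, x ∈ Set.Ico (-(1 - θ)) θ ∧ IsGeneric (1 - θ) θ x ∧
      M = exchangeWord [a] [b] (1 - θ) θ M.length x := by
  obtain ⟨i, hi⟩ := hM
  set n := M.length
  have hev : ∀ᶠ ε in nhdsWithin (0 : ℝ) (Set.Ioi 0), ∀ j ∈ Set.Iic n,
      ⌊ρ + i * θ + j * θ + ε⌋ = ⌊ρ + i * θ + j * θ⌋ ∧
      ⌊ρ + i * θ + j * θ - ε⌋ = ⌈ρ + i * θ + j * θ⌉ - 1 :=
    (Filter.eventually_all_finite (Set.finite_Iic n)).2 fun j _ =>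
      (eventually_floor_add_eq _).and (eventually_floor_sub_eq _)
  obtain ⟨δ, hδ, hδ'⟩ := mem_nhdsGT_iff_exists_Ioo_subset.1 hev
  obtain ⟨ε, hεg, hε⟩ :=
    ((countable_int_combinations θ (ρ + i * θ)).dense_compl ℝ).exists_between hδ
  have hfl := hδ' hε
  have hε' : ∀ m l : ℤ, ρ + i * θ + ε ≠ m + l * θ ∧ ρ + i * θ - ε ≠ m + l * θ := fun m l =>
    ⟨fun e => hεg ⟨m, l, Or.inl e⟩, fun e => hεg ⟨m, l, Or.inr e⟩⟩
  suffices h : ∃ r : ℝ, (∀ m l : ℤ, r ≠ m + l * θ) ∧ ∀ j < n, s (i + j + 1) =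
      if ⌊r + ((j : ℝ) + 1) * θ⌋ - ⌊r + (j : ℝ) * θ⌋ = 0 then a else b by
    obtain ⟨r, hr, hj⟩ := h
    refine ⟨Int.fract r - (1 - θ), ⟨by linarith [Int.fract_nonneg r],
      by linarith [Int.fract_lt_one r]⟩, ?_, ?_⟩
    · intro m l e
      apply hr (⌊r⌋ + m + 1) (l - m - 1)
      rw [← Int.self_sub_floor] at e
      push_cast
      linarith
    · rw [← map_floor_eq_exchangeWord a b θ h0 h1 n r]
      refine hi.trans (List.map_congr_left fun j hjn => hj j (List.mem_range.1 hjn))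
  have e1 : ∀ j : ℕ, ((i + j + 1 : ℕ) : ℝ) * θ + ρ = ρ + i * θ + ((j + 1 : ℕ) : ℝ) * θ := by
    intro j; push_cast; ring
  have e2 : ∀ j : ℕ, (((i + j + 1 : ℕ) : ℝ) - 1) * θ + ρ = ρ + i * θ + (j : ℝ) * θ := by
    intro j; push_cast; ring
  rcases hs with rfl | rfl
  · refine ⟨ρ + i * θ + ε, fun m l => (hε' m l).1, fun j hj => ?_⟩
    have f1 := (hfl (j + 1) (Set.mem_Iic.2 hj)).1
    have f2 := (hfl j (Set.mem_Iic.2 hj.le)).1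
    rw [mechWord, e1, e2, ← f1, ← f2, Nat.cast_add_one, add_right_comm _ ε, add_right_comm _ ε]
  · refine ⟨ρ + i * θ - ε, fun m l => (hε' m l).2, fun j hj => ?_⟩
    have f1 := (hfl (j + 1) (Set.mem_Iic.2 hj)).2
    have f2 := (hfl j (Set.mem_Iic.2 hj.le)).2
    rw [mechWord', e1, e2, sub_add_eq_add_sub, sub_add_eq_add_sub, ← Nat.cast_add_one, f1, f2,
      sub_sub_sub_cancel_right]

lemma length_sturmM (a b : ℕ) (d : ℕ → ℕ) (k : ℕ) :
    (sturmM a b d (k + 1)).length = cfQ d k := by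
  induction k using Nat.strong_induction_on with
  | _ k ih =>
    match k with
    | 0 => simp [sturmM, cfQ]
    | 1 => simp [sturmM, cfQ, add_comm]
    | k + 2 =>
      rw [sturmM, List.length_append, List.length_flatten, List.map_replicate, List.sum_replicate,
        ih (k + 1) (by omega), ih k (by omega), cfQ, smul_eq_mul]

lemma flatten_replicate_append_comm (d : ℕ) (A : List ℕ) :
    (List.replicate d A).flatten ++ A = A ++ (List.replicate d A).flatten := by
  induction d with
  | zero => simp
  | succ d ih => rw [List.replicate_succ, List.flatten_cons, List.append_assoc, ih]

lemma sturmM_append_comm (a b : ℕ) (d : ℕ → ℕ) (k : ℕ) :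
    ∃ z x y, sturmM a b d (k + 1) ++ sturmM a b d k = z ++ [x, y] ∧
      sturmM a b d k ++ sturmM a b d (k + 1) = z ++ [y, x] := by
  induction k with
  | zero => exact ⟨[], a, b, rfl, rfl⟩
  | succ k ih =>
    obtain ⟨z, x, y, h1, h2⟩ := ih
    refine ⟨(List.replicate (d (k + 1)) (sturmM a b d (k + 1))).flatten ++ z, y, x, ?_, ?_⟩
    · rw [sturmM, List.append_assoc, h2, List.append_assoc]
    · rw [sturmM, ← List.append_assoc, ← flatten_replicate_append_comm, List.append_assoc, h1,
        List.append_assoc]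

lemma dropLast_sturmM_prefix (a b : ℕ) (d : ℕ → ℕ) (hd : ∀ k, 1 ≤ k → 1 ≤ d k) (k : ℕ) :
    (sturmM a b d k).dropLast <+: sturmM a b d (k + 1) := by
  match k with
  | 0 => simp [sturmM]
  | k + 1 =>
    refine (List.dropLast_prefix _).trans ?_
    obtain ⟨e, he⟩ := Nat.exists_eq_add_of_le (hd (k + 1) (by omega))
    rw [sturmM, he, add_comm 1 e, List.replicate_succ, List.flatten_cons, List.append_assoc]
    exact List.prefix_append _ _

/-- A word that is a nonempty product of blocks `B` and `A ++ B` starting with `B`, possibly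
followed by `A`. -/
def IsBlockProduct (A B w : List ℕ) : Prop :=
  ∃ L : List (List ℕ), (∀ X ∈ L, X = B ∨ X = A ++ B) ∧
    (w = B ++ L.flatten ∨ w = B ++ L.flatten ++ A)

lemma IsBlockProduct.append {A B w w' : List ℕ} (h : IsBlockProduct A B w)
    (h' : IsBlockProduct A B w') : IsBlockProduct A B (w ++ w') := by
  obtain ⟨L, hL, hw⟩ := h
  obtain ⟨L', hL', hw'⟩ := h'
  rcases hw with rfl | rfl
  · refine ⟨L ++ B :: L', ?_, ?_⟩
    · intro X hX
      simp only [List.mem_append, List.mem_cons] at hX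
      rcases hX with h | rfl | h
      · exact hL _ h
      · exact Or.inl rfl
      · exact hL' _ h
    · rcases hw' with rfl | rfl <;> simp
  · refine ⟨L ++ (A ++ B) :: L', ?_, ?_⟩
    · intro X hX
      simp only [List.mem_append, List.mem_cons] at hX
      rcases hX with h | rfl | h
      · exact hL _ h
      · exact Or.inr rfl
      · exact hL' _ h
    · rcases hw' with rfl | rfl <;> simp

lemma IsBlockProduct.exchangeWord {A B X Y : List ℕ} (hX : IsBlockProduct A B X)
    (hY : IsBlockProduct A B Y) (u v : ℝ) (n : ℕ) (x : ℝ) :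
    IsBlockProduct A B (exchangeWord X Y u v (n + 1) x) := by
  induction n generalizing x with
  | zero =>
    rw [_root_.exchangeWord]
    split_ifs <;> simpa [_root_.exchangeWord]
  | succ n ih =>
    rw [_root_.exchangeWord]
    split_ifs
    exacts [hX.append (ih _), hY.append (ih _)]

lemma IsBlockProduct.prefix_flatten {A B w : List ℕ} (h : IsBlockProduct A B w) :
    ∃ L : List (List ℕ), (∀ X ∈ L, X = B ∨ X = A ++ B) ∧ w <+: L.flatten := by
  obtain ⟨L, hL, rfl | rfl⟩ := h
  · refine ⟨B :: L, ?_, by simp⟩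
    simpa using hL
  · refine ⟨B :: L ++ [A ++ B], ?_, by simp⟩
    intro X hX
    simp only [List.mem_append, List.mem_cons, List.not_mem_nil, or_false] at hX
    rcases hX with (rfl | h) | rfl
    · exact Or.inl rfl
    · exact hL _ h
    · exact Or.inr rfl

/-- A factor of a product of blocks that is no longer than any block meets at most two of them. -/
lemma infix_flatten_cases {w : List ℕ} {L : List (List ℕ)} (hL : ∀ X ∈ L, w.length ≤ X.length)
    (h : w <:+: L.flatten) :
    w = [] ∨ (∃ X ∈ L, w <:+: X) ∨
      ∃ X ∈ L, ∃ Y ∈ L, ∃ U V, w = U ++ V ∧ U <:+ X ∧ V <+: Y := by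
  induction L with
  | nil => left; simpa using h
  | cons X L ih =>
    rw [List.flatten_cons, List.infix_append_iff] at h
    rcases h with h | h | ⟨U, V, rfl, hU, hV⟩
    · exact Or.inr (Or.inl ⟨X, by simp, h⟩)
    · rcases ih (fun Y hY => hL Y (by simp [hY])) h with h | ⟨Y, hY, h⟩ | ⟨Y, hY, Z, hZ, h⟩
      · exact Or.inl h
      · exact Or.inr (Or.inl ⟨Y, by simp [hY], h⟩)
      · exact Or.inr (Or.inr ⟨Y, by simp [hY], Z, by simp [hZ], h⟩)
    · match L with
      | [] =>
        obtain rfl : V = [] := by simpa using hV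
        exact Or.inr (Or.inl ⟨X, by simp, by simpa using hU.isInfix⟩)
      | Y :: L =>
        refine Or.inr (Or.inr ⟨X, by simp, Y, by simp, U, V, rfl, hU, ?_⟩)
        have := hL Y (by simp)
        rw [List.length_append] at this
        exact List.prefix_of_prefix_length_le hV (by simp) (by omega)

lemma factor_infix_blocks (a b : ℕ) (d : ℕ → ℕ) (hd : ∀ k, 1 ≤ k → 1 ≤ d k) (θ ρ : ℝ)
    (hθ : Irrational θ)
    (hθd : Tendsto (fun k => (cfP d k : ℝ) / (cfQ d k : ℝ)) atTop (nhds θ)) (s : ℕ → ℕ)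
    (hs : s = mechWord a b θ ρ ∨ s = mechWord' a b θ ρ) (k : ℕ) (M : List ℕ)
    (hM : IsFactorSeq s M) :
    ∃ L : List (List ℕ), (∀ X ∈ L, X = sturmM a b d (k + 2) ∨
      X = sturmM a b d (k + 1) ++ sturmM a b d (k + 2)) ∧ M <:+: L.flatten := by
  have hgap := cfGap_pos d θ hθ hθd
  have h0 : 0 < θ := by simpa [cfGap, cfQ, cfP] using hgap 0
  have h1 : θ < 1 := by
    have h := hgap 1
    simp only [cfGap, cfQ, cfP] at h
    push_cast at h
    nlinarith [(Nat.cast_nonneg (d 1) : (0 : ℝ) ≤ d 1)]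
  obtain ⟨x, hx, hg, hMx⟩ := factor_eq_exchangeWord a b θ ρ h0 h1 s hs M hM
  obtain ⟨n, y, h, -, -⟩ := exchangeWord_infix_sturmM a b d θ hgap (k + 1) M.length x hx hg
  rw [← hMx] at h
  match n with
  | 0 => exact ⟨[], by simp, by simpa [exchangeWord] using h⟩
  | n + 1 =>
    have hB : IsBlockProduct (sturmM a b d (k + 1)) (sturmM a b d (k + 2))
        (sturmM a b d (k + 2)) := ⟨[], by simp, by simp⟩
    have hA : IsBlockProduct (sturmM a b d (k + 1)) (sturmM a b d (k + 2))
        (sturmM a b d (k + 3)) := by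
      obtain ⟨e, he⟩ := Nat.exists_eq_add_of_le (hd (k + 2) (by omega))
      refine ⟨List.replicate e (sturmM a b d (k + 2)), ?_, Or.inr ?_⟩
      · exact fun X hX => Or.inl (List.eq_of_mem_replicate hX)
      · conv_lhs => rw [sturmM]
        rw [he, add_comm 1 e, List.replicate_succ, List.flatten_cons]
    obtain ⟨L, hL, hpre⟩ := (hA.exchangeWord hB _ _ n y).prefix_flatten
    exact ⟨L, hL, h.trans hpre.isInfix⟩

/-- Lemma `factor`. Let `s` be a Sturmian word over `{a,b}` with slope
`θ = [0; 1+d₁, d₂, …]` (`d₁ ≥ 1`), and let `M` be a factor of `s` of length `n` with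
`q_k ≤ n ≤ q_{k+1} - 1`.  Then either `M` is a factor of a word `M_k M_k ⋯ M_k M_{k-1}`,
or `M = U V` with `U` a suffix of `M_{k+1}` and `V` a prefix of `M_{k+1}` with
`|V| ≥ q_k - 1`.  (Recall `sturmM a b d (k+1) = M_k` and `cfQ d k = q_k`.) -/
theorem stmt4 (a b : ℕ) (ha : 0 < a) (hb : 0 < b) (hab : a ≠ b)
    (d : ℕ → ℕ) (hd : ∀ k, 1 ≤ k → 1 ≤ d k)
    (θ ρ : ℝ) (hθ : Irrational θ) (hρ : ρ ∈ Set.Ico (0 : ℝ) 1)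
    (hθd : Tendsto (fun k => (cfP d k : ℝ) / (cfQ d k : ℝ)) atTop (nhds θ))
    (s : ℕ → ℕ) (hs : s = mechWord a b θ ρ ∨ s = mechWord' a b θ ρ)
    (k n : ℕ) (M : List ℕ) (hM : IsFactorSeq s M) (hlen : M.length = n)
    (h1 : cfQ d k ≤ n) (h2 : n ≤ cfQ d (k + 1) - 1) :
    (∃ m : ℕ,
        M <:+: ((List.replicate m (sturmM a b d (k + 1))).flatten ++ sturmM a b d k)) ∨
    (∃ U V : List ℕ, M = U ++ V ∧ U <:+ sturmM a b d (k + 2) ∧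
        V <+: sturmM a b d (k + 2) ∧ cfQ d k - 1 ≤ V.length) := by
  have hn : M.length < (sturmM a b d (k + 2)).length := by
    rw [length_sturmM, hlen]
    have := cfQ_pos d (k + 1)
    omega
  obtain ⟨L, hL, hML⟩ := factor_infix_blocks a b d hd θ ρ hθ hθd s hs k M hM
  have hpow : ∀ X ∈ L, ∃ m, X = (List.replicate (m + 1) (sturmM a b d (k + 1))).flatten ++
      sturmM a b d k := by
    obtain ⟨e, he⟩ := Nat.exists_eq_add_of_le (hd (k + 1) (by omega))
    intro X hX
    rcases hL X hX with rfl | rfl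
    · exact ⟨e, by rw [sturmM, he, add_comm 1 e]⟩
    · refine ⟨e + 1, ?_⟩
      rw [List.replicate_succ, List.flatten_cons, sturmM, he, add_comm 1 e, List.append_assoc]
  have hlenL : ∀ X ∈ L, M.length ≤ X.length := by
    intro X hX
    rcases hL X hX with rfl | rfl
    · exact hn.le
    · rw [List.length_append]
      omega
  rcases infix_flatten_cases hlenL hML with rfl | ⟨X, hX, hMX⟩ | ⟨X, hX, Y, hY, U, V, rfl, hU, hV⟩
  · exact Or.inl ⟨0, List.nil_infix⟩
  · obtain ⟨m, rfl⟩ := hpow X hX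
    exact Or.inl ⟨m + 1, hMX⟩
  rw [List.length_append] at hn
  by_cases hVlen : cfQ d k - 1 ≤ V.length
  · refine Or.inr ⟨U, V, rfl, ?_, ?_, hVlen⟩
    · rcases hL X hX with rfl | rfl
      · exact hU
      · exact List.suffix_of_suffix_length_le hU (List.suffix_append _ _) (by omega)
    · rcases hL Y hY with rfl | rfl
      · exact hV
      · refine List.IsPrefix.trans ?_ (List.dropLast_prefix (sturmM a b d (k + 2)))
        refine List.prefix_of_prefix_length_le hV ?_ (by rw [List.length_dropLast]; omega)
        have hne : sturmM a b d k ≠ [] := by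
          match k with
          | 0 => simp [sturmM]
          | k + 1 =>
            apply List.ne_nil_of_length_pos
            rw [length_sturmM]
            exact cfQ_pos d k
        rw [sturmM, List.dropLast_append_of_ne_nil hne, ← List.append_assoc,
          ← flatten_replicate_append_comm, List.append_assoc, List.prefix_append_right_inj]
        exact (dropLast_sturmM_prefix a b d hd k).trans (List.prefix_append _ _)
  · obtain ⟨m, rfl⟩ := hpow X hX
    obtain ⟨m', rfl⟩ := hpow Y hY
    obtain ⟨z, x, y, hz, hz'⟩ := sturmM_append_comm a b d k
    have hA := length_sturmM a b d k
    have hVA : V <+: sturmM a b d (k + 1) := by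
      refine List.prefix_of_prefix_length_le hV ?_ (by omega)
      rw [List.replicate_succ, List.flatten_cons, List.append_assoc]
      exact List.prefix_append _ _
    have hCV : sturmM a b d k ++ V <+: sturmM a b d (k + 1) ++ sturmM a b d k := by
      have hl := congrArg List.length hz'
      simp only [List.length_append, List.length_cons, List.length_nil] at hl
      refine List.IsPrefix.trans (l₂ := z) ?_ (hz ▸ List.prefix_append _ _)
      refine List.prefix_of_prefix_length_le ((List.prefix_append_right_inj _).2 hVA)
        (hz' ▸ List.prefix_append _ _) ?_
      rw [List.length_append]
      omega
    refine Or.inl ⟨m + 1 + 1, ?_⟩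
    obtain ⟨t, ht⟩ := hU
    obtain ⟨t', ht'⟩ := hCV
    refine ⟨t, t', ?_⟩
    rw [← List.append_assoc t, ht, List.replicate_succ' (n := m + 1), List.flatten_concat]
    rw [List.append_assoc] at ht'
    rw [List.append_assoc, List.append_assoc, List.append_assoc, ht']
end
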